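/- Let g satisfy the hypotheses of the main mean value theorem with parameters κ and β. Then for every nonzero integer q, ∑_{n≤x, (n,q)=1} g(n)/n = c_q(g)(log x)^κ + O(δ(q)(log x)^{β−1}) uniformly in x ≥ 2 and q, where c_q(g) = Γ(κ+1)^{-1} (φ(q)/q)^κ ∏_{p∤q} (1−1/p)^κ (1 + g(p)/p + g(p²)/p² + ⋯) and δ(q) = 1 + ∑_{p∣q} |g(p)|(log p)/p. -/

import Mathlib

open Finset Filter

theorem log_factorial_eq_sum_factorization (N : ℕ) :
    Real.log (N.factorial) =
      ∑ p ∈ (range (N + 1)).filter Nat.Prime, (N.factorial.factorization p : ℝ) * Real.log p := by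
  rw [Real.log_nat_eq_sum_factorization, Finsupp.sum]
  refine sum_subset (fun p hp => ?_) (fun p _ hp => ?_)
  · have hp' := Nat.prime_of_mem_primeFactors hp
    have := (hp'.dvd_factorial).1 (Nat.dvd_of_mem_primeFactors hp)
    simp only [mem_filter, mem_range]
    exact ⟨by omega, hp'⟩
  · rw [Finsupp.notMem_support_iff.1 hp]; simp

theorem div_le_factorization_factorial {p : ℕ} (hp : p.Prime) (N : ℕ) :
    (N : ℝ) / p - 1 ≤ N.factorial.factorization p := by
  have := Fact.mk hp
  have h1 : N / p ≤ N.factorial.factorization p := by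
    rw [Nat.factorization_def _ hp, ← padicValNat_mul_div_factorial, padicValNat_factorial_mul]
    omega
  have h2 : (N : ℝ) / p < (N / p : ℕ) + 1 := by
    rw [← Nat.floor_div_eq_div (K := ℝ)]
    exact Nat.lt_floor_add_one _
  have h3 : ((N / p : ℕ) : ℝ) ≤ N.factorial.factorization p := by exact_mod_cast h1
  linarith

theorem factorization_factorial_le {p : ℕ} (hp : p.Prime) (N : ℕ) :
    (N.factorial.factorization p : ℝ) ≤ N / p + 2 * N / (p : ℝ) ^ 2 := by
  have h1 : (p - 1) * N.factorial.factorization p ≤ N := by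
    rw [Nat.sub_one_mul_factorization_factorial hp]; omega
  have hp2 : (2 : ℝ) ≤ p := by exact_mod_cast hp.two_le
  have h2 : ((p : ℝ) - 1) * N.factorial.factorization p ≤ N := by
    have : (((p - 1 : ℕ) : ℝ)) * N.factorial.factorization p ≤ N := by exact_mod_cast h1
    rwa [Nat.cast_sub hp.one_le, Nat.cast_one] at this
  have h3 : (N.factorial.factorization p : ℝ) ≤ N / ((p : ℝ) - 1) := by
    rw [le_div_iff₀ (by linarith)]; linarith
  refine h3.trans ?_
  have hN : (0 : ℝ) ≤ N := Nat.cast_nonneg N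
  have : (N : ℝ) / p + 2 * N / (p : ℝ) ^ 2 - N / ((p : ℝ) - 1)
      = N * (p - 2) / ((p : ℝ) ^ 2 * (p - 1)) := by
    have : (p : ℝ) - 1 ≠ 0 := by linarith
    field_simp
    ring
  have h4 : 0 ≤ N * ((p : ℝ) - 2) / ((p : ℝ) ^ 2 * (p - 1)) :=
    div_nonneg (mul_nonneg hN (by linarith)) (mul_nonneg (by positivity) (by linarith))
  linarith

theorem summable_log_div_sq : Summable (fun n : ℕ => Real.log n / (n : ℝ) ^ 2) := by
  have h : Summable (fun n : ℕ => 2 * (1 / (n : ℝ) ^ (3 / 2 : ℝ))) :=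
    (Real.summable_one_div_nat_rpow.2 (by norm_num)).mul_left 2
  refine h.of_nonneg_of_le (fun n => div_nonneg (Real.log_natCast_nonneg n) (by positivity)) ?_
  intro n
  rcases Nat.eq_zero_or_pos n with rfl | hn
  · simp
  have hn' : (0 : ℝ) < n := by exact_mod_cast hn
  have h1 := Real.log_le_rpow_div hn'.le (ε := 1 / 2) (by norm_num)
  have h2 : (n : ℝ) ^ 2 = (n : ℝ) ^ (1 / 2 : ℝ) * (n : ℝ) ^ (3 / 2 : ℝ) := by
    rw [← Real.rpow_add hn', ← Real.rpow_natCast]; norm_num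
  have h3 : 0 < (n : ℝ) ^ (1 / 2 : ℝ) := by positivity
  have h4 : 0 < (n : ℝ) ^ (3 / 2 : ℝ) := by positivity
  rw [h2, div_le_iff₀ (by positivity)]
  calc Real.log n ≤ _ := h1
    _ = _ := by field_simp

/-- The first theorem of Mertens on the sum of `log p / p`. -/
theorem exists_abs_sum_log_div_prime_sub_log_le :
    ∃ C : ℝ, ∀ N : ℕ, 1 ≤ N →
      |∑ p ∈ (range (N + 1)).filter Nat.Prime, Real.log p / p - Real.log N| ≤ C := by
  refine ⟨Real.log 4 + 1 + 2 * ∑' n : ℕ, Real.log n / (n : ℝ) ^ 2, fun N hN => ?_⟩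
  have hN' : (0 : ℝ) < N := by exact_mod_cast hN
  set S := ∑ p ∈ (range (N + 1)).filter Nat.Prime, Real.log p / p with hS
  set T := ∑' n : ℕ, Real.log n / (n : ℝ) ^ 2 with hT
  have hT0 : 0 ≤ T :=
    tsum_nonneg fun n => div_nonneg (Real.log_natCast_nonneg n) (by positivity)
  have h4 : 0 ≤ Real.log 4 := Real.log_nonneg (by norm_num)
  have hup : Real.log N.factorial ≤ N * Real.log N := by
    rw [← Real.log_pow]
    exact Real.log_le_log (by exact_mod_cast N.factorial_pos) (by exact_mod_cast N.factorial_le_pow)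
  have hlow : N * Real.log N - N ≤ Real.log N.factorial := by
    have h := Real.pow_div_factorial_le_exp N hN'.le N
    have hf : (0 : ℝ) < N.factorial := by exact_mod_cast N.factorial_pos
    have h' := Real.log_le_log (by positivity) h
    rw [Real.log_exp, Real.log_div (by positivity) hf.ne', Real.log_pow] at h'
    linarith
  have hθ : ∑ p ∈ (range (N + 1)).filter Nat.Prime, Real.log p ≤ Real.log 4 * N := by
    have h := Chebyshev.theta_le_log4_mul_x hN'.le
    rw [Chebyshev.theta_eq_sum_Icc, Nat.floor_natCast, ← Nat.range_succ_eq_Icc_zero] at h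
    exact h
  have hA : N * S - Real.log 4 * N ≤ Real.log N.factorial := by
    rw [log_factorial_eq_sum_factorization]
    calc N * S - Real.log 4 * N
        ≤ ∑ p ∈ (range (N + 1)).filter Nat.Prime, (N * (Real.log p / p) - Real.log p) := by
          rw [sum_sub_distrib, ← mul_sum]; linarith
      _ ≤ _ := sum_le_sum fun p hp => by
          have := div_le_factorization_factorial (mem_filter.1 hp).2 N
          calc _ = ((N : ℝ) / p - 1) * Real.log p := by ring
            _ ≤ _ := mul_le_mul_of_nonneg_right this (Real.log_natCast_nonneg p)
  have hB : Real.log N.factorial ≤ N * S + N * (2 * T) := by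
    rw [log_factorial_eq_sum_factorization]
    calc _ ≤ ∑ p ∈ (range (N + 1)).filter Nat.Prime,
            (N * (Real.log p / p) + N * (2 * (Real.log p / (p : ℝ) ^ 2))) :=
          sum_le_sum fun p hp => by
            have := factorization_factorial_le (mem_filter.1 hp).2 N
            calc _ ≤ (N / p + 2 * N / (p : ℝ) ^ 2) * Real.log p :=
                  mul_le_mul_of_nonneg_right this (Real.log_natCast_nonneg p)
              _ = _ := by ring
      _ ≤ _ := by
          rw [sum_add_distrib, ← mul_sum, ← mul_sum, ← mul_sum]
          gcongr
          exact summable_log_div_sq.sum_le_tsum _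
            fun n _ => div_nonneg (Real.log_natCast_nonneg n) (by positivity)
  rw [abs_le]
  constructor
  · have : N * (Real.log N - 1 - 2 * T) ≤ N * S := by linarith
    have := le_of_mul_le_mul_left this hN'
    linarith
  · have : N * S ≤ N * (Real.log N + Real.log 4) := by linarith
    have := le_of_mul_le_mul_left this hN'
    linarith

/-- Multiplicative functions `a` (thought of as `n ↦ g n / n`) satisfying, with explicit constants,
the hypotheses of the mean value theorem. -/
structure MeanValueBounds (a : ℕ → ℂ) (κ : ℂ) (β A B P D : ℝ) : Prop where
  map_zero : a 0 = 0
  map_one : a 1 = 1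
  map_mul : ∀ m n : ℕ, Nat.Coprime m n → a (m * n) = a m * a n
  mertens : ∀ w : ℝ, 2 ≤ w →
    ‖(∑ p ∈ (range (⌊w⌋₊ + 1)).filter Nat.Prime, a p * (Real.log p : ℂ))
      - κ * (Real.log w : ℂ)‖ ≤ D
  summable_pow : ∀ p : Nat.Primes, Summable (fun r : ℕ => ‖a ((p : ℕ) ^ (r + 1))‖)
  summable_cross : Summable (fun p : Nat.Primes =>
    ‖a (p : ℕ)‖ * Real.log (p : ℕ) * ∑' r : ℕ, ‖a ((p : ℕ) ^ (r + 1))‖)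
  tsum_cross_le : ∑' p : Nat.Primes,
    ‖a (p : ℕ)‖ * Real.log (p : ℕ) * ∑' r : ℕ, ‖a ((p : ℕ) ^ (r + 1))‖ ≤ A
  summable_pow_log : ∀ p : Nat.Primes, Summable (fun r : ℕ =>
    ‖a ((p : ℕ) ^ (r + 2))‖ * Real.log (((p : ℕ) : ℝ) ^ (r + 2)))
  summable_high : Summable (fun p : Nat.Primes =>
    ∑' r : ℕ, ‖a ((p : ℕ) ^ (r + 2))‖ * Real.log (((p : ℕ) : ℝ) ^ (r + 2)))
  tsum_high_le : ∑' p : Nat.Primes,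
    ∑' r : ℕ, ‖a ((p : ℕ) ^ (r + 2))‖ * Real.log (((p : ℕ) : ℝ) ^ (r + 2)) ≤ B
  prod_le : ∀ x : ℝ, 2 ≤ x →
    ∏ p ∈ (range (⌊x⌋₊ + 1)).filter Nat.Prime, (1 + ‖a p‖) ≤ P * Real.log x ^ β

theorem sum_filter_prime_le_tsum {F : ℕ → ℝ} (hF : ∀ n, 0 ≤ F n)
    (hs : Summable fun p : Nat.Primes => F p) (s : Finset ℕ) :
    ∑ p ∈ s.filter Nat.Prime, F p ≤ ∑' p : Nat.Primes, F p := by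
  rw [← sum_subtype_of_mem F (p := Nat.Prime) (fun x hx => (mem_filter.1 hx).2)]
  have := Summable.sum_le_tsum (ι := Nat.Primes) (f := fun p => F p)
    ((s.filter Nat.Prime).subtype Nat.Prime) (fun p _ => hF p) hs
  exact this

theorem sum_filter_dvd_eq_sum_range_sum {E : Type*} [AddCommMonoid E] {p : ℕ} (hp : p.Prime)
    (X : ℕ) (F : ℕ → E) :
    ∑ n ∈ (Icc 1 X).filter (p ∣ ·), F n =
      ∑ r ∈ range (X + 1), ∑ m ∈ (Icc 1 (X / p ^ (r + 1))).filter (¬ p ∣ ·),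
        F (p ^ (r + 1) * m) := by
  rw [sum_sigma']
  refine sum_bij' (fun n _ => (⟨n.factorization p - 1, n / p ^ n.factorization p⟩ : Σ _ : ℕ, ℕ))
    (fun y _ => p ^ (y.1 + 1) * y.2) ?_ ?_ ?_ ?_ ?_
  · intro n hn
    simp only [mem_filter, mem_Icc] at hn
    obtain ⟨⟨h1, h2⟩, h3⟩ := hn
    have hn0 : n ≠ 0 := by omega
    have hpos := hp.factorization_pos_of_dvd hn0 h3
    have hlt : n.factorization p < n := Nat.factorization_lt _ hn0
    have he : n.factorization p - 1 + 1 = n.factorization p := by omega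
    simp only [mem_sigma, mem_range, mem_filter, mem_Icc, he]
    refine ⟨by omega, ⟨?_, Nat.div_le_div_right h2⟩, Nat.not_dvd_ordCompl hp hn0⟩
    exact Nat.ordCompl_pos p hn0
  · rintro ⟨r, m⟩ h
    simp only [mem_sigma, mem_range, mem_filter, mem_Icc] at h
    obtain ⟨h0, ⟨h1, h2⟩, h3⟩ := h
    have hpp : 0 < p ^ (r + 1) := pow_pos hp.pos _
    simp only [mem_filter, mem_Icc]
    refine ⟨⟨Nat.mul_pos hpp h1, ?_⟩, Dvd.dvd.mul_right (dvd_pow_self _ (by omega)) _⟩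
    rw [mul_comm]; exact (Nat.le_div_iff_mul_le hpp).1 h2
  · intro n hn
    simp only [mem_filter, mem_Icc] at hn
    obtain ⟨⟨h1, h2⟩, h3⟩ := hn
    have hn0 : n ≠ 0 := by omega
    have hpos := hp.factorization_pos_of_dvd hn0 h3
    have he : n.factorization p - 1 + 1 = n.factorization p := by omega
    simp only [he]
    exact Nat.ordProj_mul_ordCompl_eq_self n p
  · rintro ⟨r, m⟩ h
    simp only [mem_sigma, mem_range, mem_filter, mem_Icc] at h
    obtain ⟨h0, ⟨h1, h2⟩, h3⟩ := h
    have hpp : 0 < p ^ (r + 1) := pow_pos hp.pos _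
    have hf : (p ^ (r + 1) * m).factorization p = r + 1 := by
      rw [Nat.factorization_mul hpp.ne' (by omega), hp.factorization_pow]
      simp [Nat.factorization_eq_zero_of_not_dvd h3]
    simp only [hf]
    rw [Nat.mul_div_cancel_left _ hpp]; rfl
  · intro n hn
    simp only [mem_filter, mem_Icc] at hn
    obtain ⟨⟨h1, h2⟩, h3⟩ := hn
    have hn0 : n ≠ 0 := by omega
    have hpos := hp.factorization_pos_of_dvd hn0 h3
    have he : n.factorization p - 1 + 1 = n.factorization p := by omega
    simp only [he]
    rw [Nat.ordProj_mul_ordCompl_eq_self n p]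

namespace MeanValueBounds

variable {a : ℕ → ℂ} {κ : ℂ} {β A B P D : ℝ}

theorem map_prime_pow_mul (h : MeanValueBounds a κ β A B P D) {p m : ℕ} (hp : p.Prime)
    (hm : ¬ p ∣ m) (r : ℕ) : a (p ^ r * m) = a (p ^ r) * a m :=
  h.map_mul _ _ (Nat.Coprime.pow_left _ ((Nat.Prime.coprime_iff_not_dvd hp).2 hm))

theorem sum_Icc_div_filter_le (X k : ℕ) (Q : ℕ → Prop) [DecidablePred Q] :
    ∑ m ∈ (Icc 1 (X / k)).filter Q, ‖a m‖ ≤ ∑ m ∈ Icc 1 X, ‖a m‖ := by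
  refine sum_le_sum_of_subset_of_nonneg (fun m hm => ?_) fun _ _ _ => norm_nonneg _
  simp only [mem_filter, mem_Icc] at hm ⊢
  exact ⟨hm.1.1, hm.1.2.trans (Nat.div_le_self _ _)⟩

theorem sum_filter_dvd_le (h : MeanValueBounds a κ β A B P D) (p : Nat.Primes) (X : ℕ) :
    ∑ m ∈ (Icc 1 X).filter ((p : ℕ) ∣ ·), ‖a m‖
      ≤ (∑' r : ℕ, ‖a ((p : ℕ) ^ (r + 1))‖) * ∑ m ∈ Icc 1 X, ‖a m‖ := by
  rw [sum_filter_dvd_eq_sum_range_sum p.2]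
  calc _ ≤ ∑ r ∈ range (X + 1), ‖a ((p : ℕ) ^ (r + 1))‖ * ∑ m ∈ Icc 1 X, ‖a m‖ := by
        refine sum_le_sum fun r _ => ?_
        calc _ = ∑ m ∈ (Icc 1 (X / (p : ℕ) ^ (r + 1))).filter (¬ (p : ℕ) ∣ ·),
                ‖a ((p : ℕ) ^ (r + 1))‖ * ‖a m‖ := by
              refine sum_congr rfl fun m hm => ?_
              rw [h.map_prime_pow_mul p.2 (mem_filter.1 hm).2, norm_mul]
          _ ≤ _ := by
              rw [← mul_sum]
              exact mul_le_mul_of_nonneg_left (sum_Icc_div_filter_le _ _ _) (norm_nonneg _)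
    _ ≤ _ := by
        rw [← sum_mul]
        exact mul_le_mul_of_nonneg_right
          ((h.summable_pow p).sum_le_tsum _ fun _ _ => norm_nonneg _)
          (sum_nonneg fun _ _ => norm_nonneg _)

theorem norm_sum_factorization_sub_le (h : MeanValueBounds a κ β A B P D) (p : Nat.Primes)
    (X : ℕ) :
    ‖∑ n ∈ (Icc 1 X).filter ((p : ℕ) ∣ ·), a n * ((n.factorization p : ℝ) * Real.log (p : ℕ) : ℝ)
        - ∑ m ∈ Icc 1 (X / p), a m * (a p * (Real.log (p : ℕ) : ℂ))‖
      ≤ (‖a (p : ℕ)‖ * Real.log (p : ℕ) * (∑' r : ℕ, ‖a ((p : ℕ) ^ (r + 1))‖)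
          + ∑' r : ℕ, ‖a ((p : ℕ) ^ (r + 2))‖ * Real.log (((p : ℕ) : ℝ) ^ (r + 2)))
        * ∑ m ∈ Icc 1 X, ‖a m‖ := by
  have hlog : 0 ≤ Real.log (p : ℕ) := Real.log_natCast_nonneg _
  have hS : 0 ≤ ∑ m ∈ Icc 1 X, ‖a m‖ := sum_nonneg fun _ _ => norm_nonneg _
  have hterm : ∀ r : ℕ, ∀ m ∈ (Icc 1 (X / (p : ℕ) ^ (r + 1))).filter (¬ (p : ℕ) ∣ ·),
      a ((p : ℕ) ^ (r + 1) * m) *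
        ((((p : ℕ) ^ (r + 1) * m).factorization p : ℝ) * Real.log (p : ℕ) : ℝ)
      = a m * (a ((p : ℕ) ^ (r + 1)) * (Real.log (((p : ℕ) : ℝ) ^ (r + 1)) : ℂ)) := by
    intro r m hm
    obtain ⟨hm1, hm2⟩ := mem_filter.1 hm
    have hm0 : m ≠ 0 := by have := (mem_Icc.1 hm1).1; omega
    have hf : ((p : ℕ) ^ (r + 1) * m).factorization p = r + 1 := by
      rw [Nat.factorization_mul (pow_pos p.2.pos _).ne' hm0, p.2.factorization_pow]
      simp [Nat.factorization_eq_zero_of_not_dvd hm2]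
    rw [h.map_prime_pow_mul p.2 hm2, hf, Real.log_pow]
    push_cast
    ring
  rw [sum_filter_dvd_eq_sum_range_sum p.2, sum_range_succ']
  have h0 : ∑ m ∈ (Icc 1 (X / (p : ℕ) ^ (0 + 1))).filter (¬ (p : ℕ) ∣ ·),
      a ((p : ℕ) ^ (0 + 1) * m) *
        ((((p : ℕ) ^ (0 + 1) * m).factorization p : ℝ) * Real.log (p : ℕ) : ℝ)
      = ∑ m ∈ Icc 1 (X / p), a m * (a p * (Real.log (p : ℕ) : ℂ))
        - ∑ m ∈ (Icc 1 (X / p)).filter ((p : ℕ) ∣ ·), a m * (a p * (Real.log (p : ℕ) : ℂ)) := by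
    rw [sum_congr rfl (hterm 0), ← sum_filter_not_add_sum_filter (Icc 1 (X / p)) ((p : ℕ) ∣ ·)]
    simp
  rw [h0]
  have h1 : ‖∑ m ∈ (Icc 1 (X / p)).filter ((p : ℕ) ∣ ·), a m * (a p * (Real.log (p : ℕ) : ℂ))‖
      ≤ ‖a (p : ℕ)‖ * Real.log (p : ℕ) * (∑' r : ℕ, ‖a ((p : ℕ) ^ (r + 1))‖)
        * ∑ m ∈ Icc 1 X, ‖a m‖ := by
    rw [← sum_mul, norm_mul, norm_mul, Complex.norm_real, Real.norm_of_nonneg hlog]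
    have h2 : ‖∑ m ∈ (Icc 1 (X / p)).filter ((p : ℕ) ∣ ·), a m‖
        ≤ (∑' r : ℕ, ‖a ((p : ℕ) ^ (r + 1))‖) * ∑ m ∈ Icc 1 X, ‖a m‖ :=
      (norm_sum_le _ _).trans ((h.sum_filter_dvd_le p _).trans
        (mul_le_mul_of_nonneg_left (by simpa using sum_Icc_div_filter_le X p (fun _ => True))
          (tsum_nonneg fun _ => norm_nonneg _)))
    calc _ ≤ _ := mul_le_mul_of_nonneg_right h2 (mul_nonneg (norm_nonneg _) hlog)
      _ = _ := by ring
  have h2 : ‖∑ r ∈ range X, ∑ m ∈ (Icc 1 (X / (p : ℕ) ^ (r + 1 + 1))).filter (¬ (p : ℕ) ∣ ·),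
      a ((p : ℕ) ^ (r + 1 + 1) * m) *
        ((((p : ℕ) ^ (r + 1 + 1) * m).factorization p : ℝ) * Real.log (p : ℕ) : ℝ)‖
      ≤ (∑' r : ℕ, ‖a ((p : ℕ) ^ (r + 2))‖ * Real.log (((p : ℕ) : ℝ) ^ (r + 2)))
        * ∑ m ∈ Icc 1 X, ‖a m‖ := by
    have hl : ∀ r : ℕ, 0 ≤ Real.log (((p : ℕ) : ℝ) ^ (r + 2)) := fun r => by
      rw [Real.log_pow]; positivity
    calc _ ≤ ∑ r ∈ range X, ‖a ((p : ℕ) ^ (r + 2))‖ * Real.log (((p : ℕ) : ℝ) ^ (r + 2))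
          * ∑ m ∈ Icc 1 X, ‖a m‖ := by
          refine (norm_sum_le _ _).trans (sum_le_sum fun r _ => ?_)
          rw [sum_congr rfl (hterm (r + 1)), ← sum_mul, norm_mul, norm_mul, Complex.norm_real,
            Real.norm_of_nonneg (hl r), mul_comm]
          exact mul_le_mul_of_nonneg_left ((norm_sum_le _ _).trans (sum_Icc_div_filter_le _ _ _))
            (mul_nonneg (norm_nonneg _) (hl r))
      _ ≤ _ := by
          rw [← sum_mul]
          exact mul_le_mul_of_nonneg_right
            ((h.summable_pow_log p).sum_le_tsum _ fun r _ => mul_nonneg (norm_nonneg _) (hl r)) hS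
  rw [add_mul, add_sub_assoc, sub_sub_cancel_left, ← sub_eq_add_neg]
  refine (norm_sub_le _ _).trans ?_
  linarith

theorem norm_sum_mul_log_sub_le (h : MeanValueBounds a κ β A B P D) (X : ℕ) :
    ‖∑ n ∈ Icc 1 X, a n * (Real.log n : ℂ)
        - ∑ m ∈ Icc 1 X, a m *
            ∑ p ∈ (range (X / m + 1)).filter Nat.Prime, a p * (Real.log p : ℂ)‖
      ≤ (A + B) * ∑ m ∈ Icc 1 X, ‖a m‖ := by
  have hS : 0 ≤ ∑ m ∈ Icc 1 X, ‖a m‖ := sum_nonneg fun _ _ => norm_nonneg _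
  have e1 : ∑ n ∈ Icc 1 X, a n * (Real.log n : ℂ) =
      ∑ p ∈ (range (X + 1)).filter Nat.Prime, ∑ n ∈ (Icc 1 X).filter (p ∣ ·),
        a n * ((n.factorization p : ℝ) * Real.log p : ℝ) := by
    have : ∀ n ∈ Icc 1 X, a n * (Real.log n : ℂ) =
        ∑ p ∈ n.primeFactors, a n * ((n.factorization p : ℝ) * Real.log p : ℝ) := by
      intro n _
      rw [Real.log_nat_eq_sum_factorization, Finsupp.sum, Complex.ofReal_sum, mul_sum]
      rfl
    rw [sum_congr rfl this]
    refine sum_comm' fun n p => ?_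
    simp only [mem_Icc, Nat.mem_primeFactors, mem_filter, mem_range]
    constructor
    · rintro ⟨⟨h1, h2⟩, h3, h4, h5⟩
      have := Nat.le_of_dvd (by omega) h4
      exact ⟨⟨⟨h1, h2⟩, h4⟩, by omega, h3⟩
    · rintro ⟨⟨⟨h1, h2⟩, h3⟩, h4, h5⟩
      exact ⟨⟨h1, h2⟩, h5, h3, by omega⟩
  have e2 : ∑ m ∈ Icc 1 X, a m *
        ∑ p ∈ (range (X / m + 1)).filter Nat.Prime, a p * (Real.log p : ℂ) =
      ∑ p ∈ (range (X + 1)).filter Nat.Prime, ∑ m ∈ Icc 1 (X / p),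
        a m * (a p * (Real.log p : ℂ)) := by
    simp_rw [mul_sum]
    refine sum_comm' fun m p => ?_
    simp only [mem_Icc, mem_filter, mem_range, Nat.lt_succ_iff]
    constructor
    · rintro ⟨⟨h1, h2⟩, h3, h4⟩
      have h3' := (Nat.le_div_iff_mul_le h1).1 h3
      refine ⟨⟨h1, (Nat.le_div_iff_mul_le h4.pos).2 (by rwa [mul_comm])⟩, ?_, h4⟩
      exact h3.trans (Nat.div_le_self _ _)
    · rintro ⟨⟨h1, h2⟩, h3, h4⟩
      have h2' := (Nat.le_div_iff_mul_le h4.pos).1 h2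
      refine ⟨⟨h1, h2.trans (Nat.div_le_self _ _)⟩,
        (Nat.le_div_iff_mul_le h1).2 (by rwa [mul_comm]), h4⟩
  rw [e1, e2, ← sum_sub_distrib]
  set F : ℕ → ℝ := fun p => ‖a p‖ * Real.log p * ∑' r : ℕ, ‖a (p ^ (r + 1))‖ with hF
  set G : ℕ → ℝ := fun p => ∑' r : ℕ, ‖a (p ^ (r + 2))‖ * Real.log ((p : ℝ) ^ (r + 2)) with hG
  have hF0 : ∀ p, 0 ≤ F p := fun p => mul_nonneg (mul_nonneg (norm_nonneg _)
    (Real.log_natCast_nonneg _)) (tsum_nonneg fun _ => norm_nonneg _)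
  have hG0 : ∀ p, 0 ≤ G p := fun p => tsum_nonneg fun r => mul_nonneg (norm_nonneg _) (by
    rw [Real.log_pow]; exact mul_nonneg (Nat.cast_nonneg _) (Real.log_natCast_nonneg _))
  calc _ ≤ ∑ p ∈ (range (X + 1)).filter Nat.Prime, (F p + G p) * ∑ m ∈ Icc 1 X, ‖a m‖ :=
        (norm_sum_le _ _).trans (sum_le_sum fun p hp =>
          h.norm_sum_factorization_sub_le ⟨p, (mem_filter.1 hp).2⟩ X)
    _ ≤ _ := by
        rw [← sum_mul, sum_add_distrib]
        refine mul_le_mul_of_nonneg_right (add_le_add ?_ ?_) hS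
        · exact (sum_filter_prime_le_tsum hF0 h.summable_cross _).trans h.tsum_cross_le
        · exact (sum_filter_prime_le_tsum hG0 h.summable_high _).trans h.tsum_high_le

end MeanValueBounds

/-- The partial sums `∑ a n` over `1 ≤ n ≤ exp t`. -/
noncomputable def expSum (a : ℕ → ℂ) (t : ℝ) : ℂ := ∑ n ∈ Icc 1 ⌊Real.exp t⌋₊, a n

/-- The logarithmic integral `∑ a n (t - log n)` of `expSum a`. -/
noncomputable def expSumPrimitive (a : ℕ → ℂ) (t : ℝ) : ℂ :=
  ∑ n ∈ Icc 1 ⌊Real.exp t⌋₊, a n * ((t - Real.log n : ℝ) : ℂ)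

theorem expSum_log (a : ℕ → ℂ) {x : ℝ} (hx : 0 < x) :
    expSum a (Real.log x) = ∑ n ∈ Icc 1 ⌊x⌋₊, a n := by
  rw [expSum, Real.exp_log hx]

theorem Icc_floor_exp_eq_filter {u : ℝ} {Y : ℕ} (hY : ⌊Real.exp u⌋₊ ≤ Y) :
    Icc 1 ⌊Real.exp u⌋₊ = (Icc 1 Y).filter (fun n : ℕ => Real.log n ≤ u) := by
  ext n
  simp only [mem_Icc, mem_filter]
  have key : ∀ h1 : 1 ≤ n, (Real.log n ≤ u ↔ n ≤ ⌊Real.exp u⌋₊) := fun h1 => by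
    rw [Real.log_le_iff_le_exp (by exact_mod_cast h1), Nat.le_floor_iff (Real.exp_pos _).le]
  constructor
  · rintro ⟨h1, h2⟩
    exact ⟨⟨h1, h2.trans hY⟩, (key h1).2 h2⟩
  · rintro ⟨⟨h1, h2⟩, h3⟩
    exact ⟨h1, (key h1).1 h3⟩

theorem expSumPrimitive_eq_sum_max (a : ℕ → ℂ) {u : ℝ} {Y : ℕ} (hY : ⌊Real.exp u⌋₊ ≤ Y) :
    expSumPrimitive a u = ∑ n ∈ Icc 1 Y, a n * ((max (u - Real.log n) 0 : ℝ) : ℂ) := by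
  rw [expSumPrimitive, Icc_floor_exp_eq_filter hY, sum_filter]
  refine sum_congr rfl fun n _ => ?_
  split_ifs with h
  · rw [max_eq_left (by linarith)]
  · rw [max_eq_right (by linarith)]; simp

theorem hasDerivWithinAt_max_sub (l u : ℝ) :
    HasDerivWithinAt (fun v : ℝ => max (v - l) 0) (if l ≤ u then 1 else 0) (Set.Ici u) u := by
  split_ifs with h
  · refine ((hasDerivWithinAt_id u _).sub_const l).congr (fun v hv => ?_) ?_
    · rw [max_eq_left]; · rfl
      have : u ≤ v := hv
      linarith
    · rw [max_eq_left]; · rfl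
      linarith
  · refine (HasDerivAt.congr_of_eventuallyEq (hasDerivAt_const u (0 : ℝ)) ?_).hasDerivWithinAt
    filter_upwards [gt_mem_nhds (not_le.1 h)] with v hv
    rw [max_eq_right (by linarith)]

theorem hasDerivWithinAt_expSumPrimitive (a : ℕ → ℂ) (u : ℝ) :
    HasDerivWithinAt (expSumPrimitive a) (expSum a u) (Set.Ici u) u := by
  set Y := ⌊Real.exp (u + 1)⌋₊
  have hY : ∀ v, v ≤ u + 1 → ⌊Real.exp v⌋₊ ≤ Y := fun v hv =>
    Nat.floor_mono (Real.exp_le_exp.2 hv)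
  have h1 : HasDerivWithinAt
      (fun v : ℝ => ∑ n ∈ Icc 1 Y, a n * ((max (v - Real.log n) 0 : ℝ) : ℂ))
      (∑ n ∈ Icc 1 Y, a n * (((if Real.log n ≤ u then 1 else 0 : ℝ)) : ℂ)) (Set.Ici u) u := by
    refine HasDerivWithinAt.fun_sum fun n _ => ?_
    exact (hasDerivWithinAt_max_sub (Real.log n) u).ofReal_comp.const_mul _
  have h2 : expSum a u = ∑ n ∈ Icc 1 Y, a n * (((if Real.log n ≤ u then 1 else 0 : ℝ)) : ℂ) := by
    rw [expSum, Icc_floor_exp_eq_filter (hY u (by linarith)), sum_filter]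
    refine sum_congr rfl fun n _ => ?_
    split_ifs <;> simp
  rw [h2]
  refine h1.congr_of_eventuallyEq ?_ (expSumPrimitive_eq_sum_max a (hY u (by linarith)))
  have : Set.Iio (u + 1) ∈ nhdsWithin u (Set.Ici u) :=
    mem_nhdsWithin_of_mem_nhds (Iio_mem_nhds (by linarith))
  filter_upwards [this] with v hv
  exact expSumPrimitive_eq_sum_max a (hY v (le_of_lt hv))

theorem continuousOn_expSumPrimitive (a : ℕ → ℂ) (s T : ℝ) :
    ContinuousOn (expSumPrimitive a) (Set.Icc s T) := by
  have h : ContinuousOn (fun v : ℝ =>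
      ∑ n ∈ Icc 1 ⌊Real.exp T⌋₊, a n * ((max (v - Real.log n) 0 : ℝ) : ℂ)) (Set.Icc s T) := by
    fun_prop
  exact h.congr fun v hv =>
    expSumPrimitive_eq_sum_max a (Nat.floor_mono (Real.exp_le_exp.2 hv.2))

/-- A function satisfying an approximate Euler-type differential equation is close to a
multiple of a power. -/
theorem exists_norm_expSum_sub_le (a : ℕ → ℂ) (κ : ℂ) (β K t₀ : ℝ) (hκ : 0 < κ.re + 1)
    (hβ : β < κ.re + 1) (ht₀ : 0 < t₀)
    (h : ∀ t : ℝ, t₀ ≤ t →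
      ‖(t : ℂ) * expSum a t - (κ + 1) * expSumPrimitive a t‖ ≤ K * t ^ β) :
    ∃ c : ℂ, ∀ t : ℝ, t₀ ≤ t →
      ‖expSum a t - c * (t : ℂ) ^ κ‖ ≤ (‖κ + 1‖ / (κ.re + 1 - β) + 1) * K * t ^ (β - 1) := by
  set α := κ.re + 1 - β with hα
  have hα0 : 0 < α := by linarith
  have hκ0 : -(κ + 1) ≠ 0 := by
    intro h0
    have := congrArg Complex.re h0
    simp at this
    linarith
  have hK : 0 ≤ K := by
    have h1 := (norm_nonneg _).trans (h t₀ le_rfl)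
    exact nonneg_of_mul_nonneg_left h1 (by positivity)
  set F : ℝ → ℂ := fun u => expSumPrimitive a u * (u : ℂ) ^ (-(κ + 1)) with hF
  have hdiff : ∀ s T : ℝ, t₀ ≤ s → s ≤ T → ‖F T - F s‖ ≤ K / α * s ^ (-α) := by
    intro s T hs hsT
    have hs0 : 0 < s := ht₀.trans_le hs
    have hcpow : ∀ u : ℝ, 0 < u → HasDerivAt (fun y : ℝ => (y : ℂ) ^ (-(κ + 1)))
        (-(κ + 1) * (u : ℂ) ^ (-(κ + 1) - 1)) u := fun u hu =>
      hasDerivAt_ofReal_cpow_const hu.ne' hκ0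
    have hcont : ContinuousOn (fun u => F u - F s) (Set.Icc s T) := by
      refine ContinuousOn.sub ((continuousOn_expSumPrimitive a s T).mul ?_) continuousOn_const
      exact fun u hu => (hcpow u (hs0.trans_le hu.1)).continuousAt.continuousWithinAt
    have hder : ∀ u ∈ Set.Ico s T, HasDerivWithinAt (fun u => F u - F s)
        (expSum a u * (u : ℂ) ^ (-(κ + 1)) +
          expSumPrimitive a u * (-(κ + 1) * (u : ℂ) ^ (-(κ + 1) - 1))) (Set.Ici u) u := fun u hu =>
      ((hasDerivWithinAt_expSumPrimitive a u).mul
        (hcpow u (hs0.trans_le hu.1)).hasDerivWithinAt).sub_const _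
    set B : ℝ → ℝ := fun u => K / α * (s ^ (-α) - u ^ (-α)) with hB
    have hrp : ∀ u : ℝ, 0 < u → HasDerivAt B (K * u ^ (-α - 1)) u := fun u hu => by
      have := ((Real.hasDerivAt_rpow_const (p := -α) (Or.inl hu.ne')).const_sub
        (s ^ (-α))).const_mul (K / α)
      convert! this using 1
      field_simp
    have hbound : ∀ u ∈ Set.Ico s T, ‖expSum a u * (u : ℂ) ^ (-(κ + 1)) +
          expSumPrimitive a u * (-(κ + 1) * (u : ℂ) ^ (-(κ + 1) - 1))‖ ≤ K * u ^ (-α - 1) := by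
      intro u hu
      have hu0 : 0 < u := hs0.trans_le hu.1
      have huC : (u : ℂ) ≠ 0 := by exact_mod_cast hu0.ne'
      have e : expSum a u * (u : ℂ) ^ (-(κ + 1)) +
          expSumPrimitive a u * (-(κ + 1) * (u : ℂ) ^ (-(κ + 1) - 1))
          = ((u : ℂ) * expSum a u - (κ + 1) * expSumPrimitive a u) *
            (u : ℂ) ^ (-(κ + 1) - 1) := by
        have : (u : ℂ) ^ (-(κ + 1)) = u * (u : ℂ) ^ (-(κ + 1) - 1) := by
          rw [Complex.cpow_sub _ _ huC, Complex.cpow_one]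
          field_simp
        rw [this]; ring
      rw [e, norm_mul, Complex.norm_cpow_eq_rpow_re_of_pos hu0]
      calc _ ≤ K * u ^ β * u ^ ((-(κ + 1) - 1 : ℂ).re) :=
            mul_le_mul_of_nonneg_right (h u (hs.trans hu.1)) (by positivity)
        _ = K * u ^ (-α - 1) := by
            rw [mul_assoc, ← Real.rpow_add hu0]
            congr 2
            simp [hα]; ring
    have := image_norm_le_of_norm_deriv_right_le_deriv_boundary' (f := fun u => F u - F s)
      (a := s) (b := T) hcont hder (B := B) (B' := fun u => K * u ^ (-α - 1))
      (by simp [hB])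
      (fun u hu => (hrp u (hs0.trans_le hu.1)).continuousAt.continuousWithinAt)
      (fun u hu => (hrp u (hs0.trans_le hu.1)).hasDerivWithinAt) hbound ⟨hsT, le_rfl⟩
    refine this.trans ?_
    have hT : 0 ≤ T ^ (-α) := Real.rpow_nonneg (hs0.le.trans hsT) _
    exact mul_le_mul_of_nonneg_left (by linarith) (by positivity)
  have htend : Tendsto (fun s : ℝ => K / α * s ^ (-α)) atTop (nhds 0) := by
    simpa using (tendsto_rpow_neg_atTop hα0).const_mul (K / α)
  have hcau : CauchySeq F := by
    rw [Metric.cauchySeq_iff']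
    intro ε hε
    obtain ⟨s, hs1, hs2⟩ := ((htend.eventually_lt_const hε).and (eventually_ge_atTop t₀)).exists
    exact ⟨s, fun T hT => by rw [dist_eq_norm]; exact (hdiff s T hs2 hT).trans_lt hs1⟩
  obtain ⟨c', hc'⟩ := cauchySeq_tendsto_of_complete hcau
  have hlim : ∀ t, t₀ ≤ t → ‖c' - F t‖ ≤ K / α * t ^ (-α) := fun t ht =>
    le_of_tendsto ((hc'.sub_const (F t)).norm)
      (by filter_upwards [eventually_ge_atTop t] with T hT using hdiff t T ht hT)
  refine ⟨(κ + 1) * c', fun t ht => ?_⟩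
  have ht0 : 0 < t := ht₀.trans_le ht
  have htC : (t : ℂ) ≠ 0 := by exact_mod_cast ht0.ne'
  have e : expSum a t - (κ + 1) * c' * (t : ℂ) ^ κ =
      ((t : ℂ) * expSum a t - (κ + 1) * expSumPrimitive a t) * (t : ℂ)⁻¹
        - (κ + 1) * (c' - F t) * (t : ℂ) ^ κ := by
    have h1 : F t * (t : ℂ) ^ κ = expSumPrimitive a t * (t : ℂ)⁻¹ := by
      rw [hF]
      simp only
      rw [mul_assoc, ← Complex.cpow_add _ _ htC, ← Complex.cpow_neg_one]
      congr 2; ring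
    have h2 : (t : ℂ) * expSum a t * (t : ℂ)⁻¹ = expSum a t := by field_simp
    rw [sub_mul, h2, mul_assoc _ (c' - F t), sub_mul, h1]
    ring
  rw [e]
  refine (norm_sub_le _ _).trans ?_
  rw [norm_mul, norm_mul, norm_mul, norm_inv, Complex.norm_real, Real.norm_of_nonneg ht0.le,
    Complex.norm_cpow_eq_rpow_re_of_pos ht0]
  have h1 := mul_le_mul_of_nonneg_right (h t ht) (inv_nonneg.2 ht0.le)
  have h2 : ‖κ + 1‖ * ‖c' - F t‖ * t ^ κ.re ≤ ‖κ + 1‖ * (K / α * t ^ (-α)) * t ^ κ.re :=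
    mul_le_mul_of_nonneg_right (mul_le_mul_of_nonneg_left (hlim t ht) (norm_nonneg _))
      (by positivity)
  have h3 : t ^ β * t⁻¹ = t ^ (β - 1) := by
    rw [Real.rpow_sub ht0, Real.rpow_one]; rfl
  have h4 : t ^ (-α) * t ^ κ.re = t ^ (β - 1) := by
    rw [← Real.rpow_add ht0]; congr 1; rw [hα]; ring
  calc _ ≤ K * t ^ β * t⁻¹ + ‖κ + 1‖ * (K / α * t ^ (-α)) * t ^ κ.re := add_le_add h1 h2
    _ = K * (t ^ β * t⁻¹) + ‖κ + 1‖ * (K / α) * (t ^ (-α) * t ^ κ.re) := by ring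
    _ = _ := by rw [h3, h4]; ring

namespace MeanValueBounds

variable {a : ℕ → ℂ} {κ : ℂ} {β A B P D : ℝ}

theorem summable_norm_pow (h : MeanValueBounds a κ β A B P D) {p : ℕ} (hp : p.Prime) :
    Summable (fun r : ℕ => ‖a (p ^ r)‖) :=
  (summable_nat_add_iff 1).1 (h.summable_pow ⟨p, hp⟩)

theorem tsum_norm_pow_add_two_le (h : MeanValueBounds a κ β A B P D) {p : ℕ} (hp : p.Prime) :
    ∑' r : ℕ, ‖a (p ^ (r + 2))‖
      ≤ ∑' r : ℕ, ‖a (p ^ (r + 2))‖ * Real.log ((p : ℝ) ^ (r + 2)) := by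
  refine Summable.tsum_le_tsum (fun r => ?_) ((summable_nat_add_iff 2).2 (h.summable_norm_pow hp))
    (h.summable_pow_log ⟨p, hp⟩)
  refine le_mul_of_one_le_right (norm_nonneg _) ?_
  have h1 : Real.log 2 ≤ Real.log p := Real.log_le_log (by norm_num) (by exact_mod_cast hp.two_le)
  have h2 := Real.log_two_gt_d9
  rw [Real.log_pow]
  push_cast
  nlinarith [Nat.cast_nonneg (α := ℝ) r]

theorem tsum_norm_pow_le (h : MeanValueBounds a κ β A B P D) {p : ℕ} (hp : p.Prime) :
    ∑' r : ℕ, ‖a (p ^ r)‖ ≤ (1 + ‖a p‖) *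
      Real.exp (∑' r : ℕ, ‖a (p ^ (r + 2))‖ * Real.log ((p : ℝ) ^ (r + 2))) := by
  rw [← (h.summable_norm_pow hp).sum_add_tsum_nat_add 2]
  have h1 := h.tsum_norm_pow_add_two_le hp
  have h2 := Real.add_one_le_exp (∑' r : ℕ, ‖a (p ^ (r + 2))‖ * Real.log ((p : ℝ) ^ (r + 2)))
  have h3 : 0 ≤ ∑' r : ℕ, ‖a (p ^ (r + 2))‖ := tsum_nonneg fun _ => norm_nonneg _
  have h4 := norm_nonneg (a p)
  simp only [sum_range_succ, range_zero, sum_empty, pow_zero, pow_one, h.map_one, norm_one]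
  nlinarith

theorem sum_norm_le (h : MeanValueBounds a κ β A B P D) {x : ℝ} (hx : 2 ≤ x) :
    ∑ m ∈ Icc 1 ⌊x⌋₊, ‖a m‖ ≤ P * Real.exp B * Real.log x ^ β := by
  obtain ⟨hs, hp⟩ := EulerProduct.summable_and_hasSum_smoothNumbers_prod_primesBelow_tsum
    (f := fun n => ‖a n‖) (by simp [h.map_one]) (fun {m n} hmn => by simp [h.map_mul m n hmn])
    (fun {p} hp => by simpa using h.summable_norm_pow hp) (⌊x⌋₊ + 1)
  have h1 : ∑ m ∈ Icc 1 ⌊x⌋₊, ‖a m‖ ≤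
      ∏ p ∈ (⌊x⌋₊ + 1).primesBelow, ∑' n : ℕ, ‖a (p ^ n)‖ := by
    classical
    rw [← sum_subtype_of_mem (fun m => ‖a m‖) (p := (· ∈ (⌊x⌋₊ + 1).smoothNumbers))]
    · exact sum_le_hasSum ((Icc 1 ⌊x⌋₊).subtype (· ∈ (⌊x⌋₊ + 1).smoothNumbers))
        (fun m _ => norm_nonneg (a m)) hp
    · intro m hm
      rw [mem_Icc] at hm
      exact Nat.mem_smoothNumbers_of_lt (by omega) (by omega)
  have hG0 : ∀ p : ℕ, 0 ≤ ∑' r : ℕ, ‖a (p ^ (r + 2))‖ * Real.log ((p : ℝ) ^ (r + 2)) :=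
    fun p => tsum_nonneg fun r => mul_nonneg (norm_nonneg _) (by
      rw [Real.log_pow]; exact mul_nonneg (Nat.cast_nonneg _) (Real.log_natCast_nonneg _))
  have h0 : 0 ≤ ∏ p ∈ (range (⌊x⌋₊ + 1)).filter Nat.Prime, (1 + ‖a p‖) :=
    prod_nonneg fun p _ => by positivity
  calc _ ≤ _ := h1
    _ ≤ ∏ p ∈ (range (⌊x⌋₊ + 1)).filter Nat.Prime, ((1 + ‖a p‖) *
        Real.exp (∑' r : ℕ, ‖a (p ^ (r + 2))‖ * Real.log ((p : ℝ) ^ (r + 2)))) :=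
        prod_le_prod (fun p _ => tsum_nonneg fun _ => norm_nonneg _)
          fun p hp => h.tsum_norm_pow_le (mem_filter.1 hp).2
    _ ≤ (P * Real.log x ^ β) * Real.exp B := by
        rw [prod_mul_distrib, ← Real.exp_sum]
        refine mul_le_mul (h.prod_le x hx) (Real.exp_le_exp.2 ?_) (Real.exp_pos _).le
          (h0.trans (h.prod_le x hx))
        exact (sum_filter_prime_le_tsum hG0 h.summable_high _).trans h.tsum_high_le
    _ = _ := by ring

theorem norm_sum_prime_sub_le (h : MeanValueBounds a κ β A B P D) {w : ℝ} (hw : 1 ≤ w) :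
    ‖(∑ p ∈ (range (⌊w⌋₊ + 1)).filter Nat.Prime, a p * (Real.log p : ℂ))
      - κ * (Real.log w : ℂ)‖ ≤ D + ‖κ‖ := by
  have hD : 0 ≤ D := (norm_nonneg _).trans (h.mertens 2 le_rfl)
  rcases le_or_gt 2 w with h2 | h2
  · linarith [h.mertens w h2, norm_nonneg κ]
  · have : (range (⌊w⌋₊ + 1)).filter Nat.Prime = ∅ := by
      refine filter_eq_empty_iff.2 fun p hp hpp => ?_
      have h3 : ⌊w⌋₊ < 2 := (Nat.floor_lt (by linarith)).2 (by exact_mod_cast h2)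
      have := hpp.two_le
      have := mem_range.1 hp
      omega
    rw [this, sum_empty, zero_sub, norm_neg, norm_mul, Complex.norm_real,
      Real.norm_of_nonneg (Real.log_nonneg hw)]
    have h3 : Real.log w ≤ 1 :=
      (Real.log_le_sub_one_of_pos (by linarith)).trans (by linarith)
    nlinarith [norm_nonneg κ]

theorem norm_log_mul_expSum_sub_le (h : MeanValueBounds a κ β A B P D) {t : ℝ}
    (ht : Real.log 2 ≤ t) :
    ‖(t : ℂ) * expSum a t - (κ + 1) * expSumPrimitive a t‖
      ≤ (A + B + D + ‖κ‖) * (P * Real.exp B) * t ^ β := by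
  obtain ⟨x, rfl, hx⟩ : ∃ x, t = Real.log x ∧ 2 ≤ x :=
    ⟨Real.exp t, (Real.log_exp t).symm, by
      rwa [← Real.log_le_iff_le_exp (by norm_num)]⟩
  have hx0 : 0 < x := by linarith
  have h1 := h.norm_sum_mul_log_sub_le ⌊x⌋₊
  have h2 : ‖∑ m ∈ Icc 1 ⌊x⌋₊, a m *
        ∑ p ∈ (range (⌊x⌋₊ / m + 1)).filter Nat.Prime, a p * (Real.log p : ℂ)
      - ∑ m ∈ Icc 1 ⌊x⌋₊, a m * (κ * ((Real.log x - Real.log m : ℝ) : ℂ))‖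
      ≤ (D + ‖κ‖) * ∑ m ∈ Icc 1 ⌊x⌋₊, ‖a m‖ := by
    rw [← sum_sub_distrib, mul_sum]
    refine (norm_sum_le _ _).trans (sum_le_sum fun m hm => ?_)
    obtain ⟨hm1, hm2⟩ := mem_Icc.1 hm
    have hm0 : (0 : ℝ) < m := by exact_mod_cast hm1
    have hmx : (m : ℝ) ≤ x := (Nat.le_floor_iff hx0.le).1 hm2
    have h3 := h.norm_sum_prime_sub_le (w := x / m) (by rwa [le_div_iff₀ hm0, one_mul])
    rw [Nat.floor_div_natCast, Real.log_div hx0.ne' hm0.ne'] at h3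
    rw [← mul_sub, norm_mul, mul_comm]
    exact mul_le_mul_of_nonneg_right h3 (norm_nonneg _)
  have e : (Real.log x : ℂ) * expSum a (Real.log x)
        - (κ + 1) * expSumPrimitive a (Real.log x) =
      (∑ n ∈ Icc 1 ⌊x⌋₊, a n * (Real.log n : ℂ)
        - ∑ m ∈ Icc 1 ⌊x⌋₊, a m *
            ∑ p ∈ (range (⌊x⌋₊ / m + 1)).filter Nat.Prime, a p * (Real.log p : ℂ))
      + (∑ m ∈ Icc 1 ⌊x⌋₊, a m *
        ∑ p ∈ (range (⌊x⌋₊ / m + 1)).filter Nat.Prime, a p * (Real.log p : ℂ)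
      - ∑ m ∈ Icc 1 ⌊x⌋₊, a m * (κ * ((Real.log x - Real.log m : ℝ) : ℂ))) := by
    rw [sub_add_sub_cancel, ← sum_sub_distrib, expSum, expSumPrimitive, Real.exp_log hx0,
      mul_sum, mul_sum, ← sum_sub_distrib]
    refine sum_congr rfl fun n _ => ?_
    push_cast
    ring
  rw [e]
  have hA : 0 ≤ A := (tsum_nonneg fun p : Nat.Primes => mul_nonneg (mul_nonneg (norm_nonneg _)
    (Real.log_natCast_nonneg _)) (tsum_nonneg fun _ => norm_nonneg _)).trans h.tsum_cross_le
  have hB : 0 ≤ B := (tsum_nonneg fun p : Nat.Primes => tsum_nonneg fun r =>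
    mul_nonneg (norm_nonneg _) (by
      rw [Real.log_pow]
      exact mul_nonneg (Nat.cast_nonneg _) (Real.log_natCast_nonneg _))).trans h.tsum_high_le
  have hD : 0 ≤ D := (norm_nonneg _).trans (h.mertens 2 le_rfl)
  have hS := h.sum_norm_le hx
  calc _ ≤ (A + B) * ∑ m ∈ Icc 1 ⌊x⌋₊, ‖a m‖ + (D + ‖κ‖) * ∑ m ∈ Icc 1 ⌊x⌋₊, ‖a m‖ :=
        (norm_add_le _ _).trans (add_le_add h1 h2)
    _ = (A + B + D + ‖κ‖) * ∑ m ∈ Icc 1 ⌊x⌋₊, ‖a m‖ := by ring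
    _ ≤ (A + B + D + ‖κ‖) * (P * Real.exp B * Real.log x ^ β) :=
        mul_le_mul_of_nonneg_left hS (by positivity)
    _ = _ := by ring

theorem exists_norm_sub_le (h : MeanValueBounds a κ β A B P D) (hβ0 : 0 ≤ β)
    (hβ : β < κ.re + 1) :
    ∃ c : ℂ, ∀ t : ℝ, Real.log 2 ≤ t → ‖expSum a t - c * (t : ℂ) ^ κ‖ ≤
      (‖κ + 1‖ / (κ.re + 1 - β) + 1) * ((A + B + D + ‖κ‖) * (P * Real.exp B)) * t ^ (β - 1) :=
  exists_norm_expSum_sub_le a κ β _ (Real.log 2) (by linarith) hβ (Real.log_pos (by norm_num))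
    fun _ ht => h.norm_log_mul_expSum_sub_le ht

end MeanValueBounds

theorem measurable_expSum (a : ℕ → ℂ) : Measurable (expSum a) := by
  have h : Measurable (fun N : ℕ => ∑ n ∈ Icc 1 N, a n) := measurable_from_nat
  exact h.comp (Nat.measurable_floor.comp Real.measurable_exp)

theorem lSeries_eq_mul_integral_expSum {a : ℕ → ℂ} {s : ℝ} (hs : 0 < s)
    (hO : (fun n => ∑ k ∈ Icc 1 n, ‖a k‖) =O[atTop] fun n : ℕ => (n : ℝ) ^ (s / 2)) :
    LSeries a s = s * ∫ u in Set.Ioi (0 : ℝ), expSum a u * (Real.exp (-(s * u)) : ℂ) := by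
  rw [LSeries_eq_mul_integral' a (by positivity) (s := (s : ℂ)) (by simpa using hs) hO]
  congr 1
  have himg : Real.exp '' Set.Ioi 0 = Set.Ioi 1 := by
    ext x
    constructor
    · rintro ⟨y, hy, rfl⟩
      exact Real.one_lt_exp_iff.2 hy
    · intro hx
      have hx : (1 : ℝ) < x := hx
      exact ⟨Real.log x, Real.log_pos hx, Real.exp_log (by linarith)⟩
  rw [← himg, MeasureTheory.integral_image_eq_integral_abs_deriv_smul (f' := Real.exp)
    measurableSet_Ioi (fun x _ => (Real.hasDerivAt_exp x).hasDerivWithinAt)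
    Real.exp_injective.injOn]
  refine MeasureTheory.setIntegral_congr_fun measurableSet_Ioi fun u _ => ?_
  have h1 : ((Real.exp u : ℝ) : ℂ) ^ (-((s : ℂ) + 1)) = ((Real.exp (-((s + 1) * u)) : ℝ) : ℂ) := by
    rw [Complex.cpow_def_of_ne_zero (by exact_mod_cast (Real.exp_pos u).ne'), ← Complex.ofReal_log
      (Real.exp_pos u).le, Real.log_exp, Complex.ofReal_exp]
    congr 1
    push_cast
    ring
  simp only [h1, expSum, abs_of_pos (Real.exp_pos u), Complex.real_smul]
  rw [mul_left_comm, ← Complex.ofReal_mul, ← Real.exp_add]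
  ring_nf

theorem norm_expSum_sub_le_of_pos {a : ℕ → ℂ} (ha1 : a 1 = 1) {κ c : ℂ} {β K b : ℝ}
    (hK : 0 ≤ K) (hβb : β ≤ b) (hb : b ≤ κ.re + 1)
    (h : ∀ t, Real.log 2 ≤ t → ‖expSum a t - c * (t : ℂ) ^ κ‖ ≤ K * t ^ (β - 1))
    {u : ℝ} (hu : 0 < u) :
    ‖expSum a u - c * (u : ℂ) ^ κ‖ ≤
      (K * Real.log 2 ^ (β - b) + 1 + ‖c‖) * (u ^ (b - 1) + u ^ (min b 1 - 1)) := by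
  have hl : 0 < Real.log 2 := Real.log_pos (by norm_num)
  have hp1 : 0 < u ^ (b - 1) := Real.rpow_pos_of_pos hu _
  have hp2 : 0 < u ^ (min b 1 - 1) := Real.rpow_pos_of_pos hu _
  have hp3 : 0 < Real.log 2 ^ (β - b) := Real.rpow_pos_of_pos hl _
  have hc := norm_nonneg c
  rcases le_or_gt (Real.log 2) u with hlu | hlu
  · refine (h u hlu).trans ?_
    have h1 : u ^ (β - 1) = u ^ (β - b) * u ^ (b - 1) := by
      rw [← Real.rpow_add hu]; ring_nf
    have h2 : u ^ (β - b) ≤ Real.log 2 ^ (β - b) :=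
      Real.rpow_le_rpow_of_nonpos hl hlu (by linarith)
    calc K * u ^ (β - 1) ≤ (K * Real.log 2 ^ (β - b)) * u ^ (b - 1) := by
          rw [h1, ← mul_assoc]; gcongr
      _ ≤ _ := by
          have : 0 ≤ K * Real.log 2 ^ (β - b) := by positivity
          gcongr <;> linarith
  · have hfl : ⌊Real.exp u⌋₊ = 1 := by
      rw [Nat.floor_eq_iff (Real.exp_pos _).le]
      constructor
      · simpa using Real.one_le_exp hu.le
      · have := (Real.lt_log_iff_exp_lt (by norm_num)).1 hlu
        norm_num; linarith
    have hu1 : u ≤ 1 := by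
      have := Real.log_two_lt_d9
      linarith
    have he : expSum a u = 1 := by simp [expSum, hfl, ha1]
    rw [he]
    have hn : ‖c * (u : ℂ) ^ κ‖ = ‖c‖ * u ^ κ.re := by
      rw [norm_mul, Complex.norm_cpow_eq_rpow_re_of_pos hu]
    have h1 : u ^ κ.re ≤ u ^ (b - 1) :=
      Real.rpow_le_rpow_of_exponent_ge hu hu1 (by linarith)
    have h2 : 1 ≤ u ^ (min b 1 - 1) :=
      Real.one_le_rpow_of_pos_of_le_one_of_nonpos hu hu1 (by linarith [min_le_right b 1])
    have h3 : 0 ≤ K * Real.log 2 ^ (β - b) := by positivity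
    calc ‖1 - c * (u : ℂ) ^ κ‖ ≤ 1 + ‖c‖ * u ^ κ.re := by
          rw [← hn]; simpa using norm_sub_le (1 : ℂ) (c * (u : ℂ) ^ κ)
      _ ≤ 1 * u ^ (min b 1 - 1) + ‖c‖ * u ^ (b - 1) := by
          rw [one_mul]; gcongr
      _ ≤ (K * Real.log 2 ^ (β - b) + 1 + ‖c‖) * u ^ (min b 1 - 1) +
          (K * Real.log 2 ^ (β - b) + 1 + ‖c‖) * u ^ (b - 1) := by
          gcongr <;> linarith
      _ = _ := by ring

theorem integrableOn_rpow_sub_one_mul_exp {b s : ℝ} (hb : 0 < b) (hs : 0 < s) :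
    MeasureTheory.IntegrableOn (fun u : ℝ => u ^ (b - 1) * Real.exp (-(s * u))) (Set.Ioi 0) := by
  have := integrableOn_rpow_mul_exp_neg_mul_rpow (p := 1) (s := b - 1) (b := s) (by linarith)
    one_pos hs
  simpa [neg_mul] using this

theorem tendsto_cpow_mul_lSeries {a : ℕ → ℂ} (ha1 : a 1 = 1) {κ c : ℂ} {β K : ℝ}
    (hK : 0 ≤ K) (hβ0 : 0 ≤ β) (hβ : β < κ.re + 1)
    (hO : ∀ s : ℝ, 0 < s →
      (fun n => ∑ k ∈ Icc 1 n, ‖a k‖) =O[atTop] fun n : ℕ => (n : ℝ) ^ s)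
    (h : ∀ t, Real.log 2 ≤ t → ‖expSum a t - c * (t : ℂ) ^ κ‖ ≤ K * t ^ (β - 1)) :
    Tendsto (fun s : ℝ => (s : ℂ) ^ κ * LSeries a s) (nhdsWithin 0 (Set.Ioi 0))
      (nhds (c * Complex.Gamma (κ + 1))) := by
  set b := (β + κ.re + 1) / 2 with hb
  have hb0 : 0 < b := by rw [hb]; linarith
  have hb1 : β ≤ b := by rw [hb]; linarith
  have hb2 : b < κ.re + 1 := by rw [hb]; linarith
  set m := min b 1 with hm
  have hm0 : 0 < m := lt_min hb0 one_pos
  have hm1 : m < κ.re + 1 := (min_le_left _ _).trans_lt hb2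
  set K1 := K * Real.log 2 ^ (β - b) + 1 + ‖c‖ with hK1
  have hbound : ∀ s : ℝ, 0 < s → ‖(s : ℂ) ^ κ * LSeries a s - c * Complex.Gamma (κ + 1)‖ ≤
      K1 * (s ^ (κ.re + 1 - b) * Real.Gamma b + s ^ (κ.re + 1 - m) * Real.Gamma m) := by
    intro s hs
    have hsc : (s : ℂ) ≠ 0 := by exact_mod_cast hs.ne'
    rw [lSeries_eq_mul_integral_expSum hs (hO (s / 2) (by positivity))]
    set G : ℝ → ℝ := fun u => K1 * (u ^ (b - 1) * Real.exp (-(s * u)) +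
      u ^ (m - 1) * Real.exp (-(s * u))) with hG
    have hGi : MeasureTheory.IntegrableOn G (Set.Ioi 0) :=
      ((integrableOn_rpow_sub_one_mul_exp hb0 hs).add
        (integrableOn_rpow_sub_one_mul_exp hm0 hs)).const_mul K1
    set F : ℝ → ℂ := fun u => (expSum a u - c * (u : ℂ) ^ κ) * (Real.exp (-(s * u)) : ℂ) with hF
    set M : ℝ → ℂ := fun u => c * (u : ℂ) ^ κ * (Real.exp (-(s * u)) : ℂ) with hM
    have hFG : ∀ᵐ u ∂(MeasureTheory.volume.restrict (Set.Ioi (0 : ℝ))), ‖F u‖ ≤ G u := by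
      filter_upwards [MeasureTheory.self_mem_ae_restrict measurableSet_Ioi] with u hu
      have hn : ‖((Real.exp (-(s * u)) : ℝ) : ℂ)‖ = Real.exp (-(s * u)) := by
        rw [Complex.norm_real, Real.norm_eq_abs, abs_of_pos (Real.exp_pos _)]
      simp only [hF, hG, norm_mul, hn]
      rw [← add_mul, ← mul_assoc]
      have := norm_expSum_sub_le_of_pos ha1 hK hb1 hb2.le h hu
      gcongr
    have hmeasc : Measurable (fun u : ℝ => (u : ℂ) ^ κ) :=
      Complex.measurable_ofReal.pow_const κ
    have hexpm : Measurable (fun u : ℝ => (Real.exp (-(s * u)) : ℂ)) :=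
      Complex.measurable_ofReal.comp (Real.measurable_exp.comp
        (measurable_id.const_mul s).neg)
    have hFi : MeasureTheory.IntegrableOn F (Set.Ioi 0) :=
      MeasureTheory.Integrable.mono' hGi
        (((measurable_expSum a).sub (hmeasc.const_mul c)).mul hexpm).aestronglyMeasurable hFG
    have hMi : MeasureTheory.IntegrableOn M (Set.Ioi 0) := by
      have h0 := integrableOn_rpow_sub_one_mul_exp (b := κ.re + 1) (by linarith) hs
      refine MeasureTheory.Integrable.mono' (h0.const_mul ‖c‖)
        ((hmeasc.const_mul c).mul hexpm).aestronglyMeasurable ?_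
      filter_upwards [MeasureTheory.self_mem_ae_restrict measurableSet_Ioi] with u hu
      rw [norm_mul, norm_mul, Complex.norm_real, Real.norm_eq_abs, abs_of_pos (Real.exp_pos _),
        Complex.norm_cpow_eq_rpow_re_of_pos hu, add_sub_cancel_right, mul_assoc]
    have hsplit : ∫ u in Set.Ioi (0 : ℝ), expSum a u * (Real.exp (-(s * u)) : ℂ) =
        (∫ u in Set.Ioi (0 : ℝ), F u) + ∫ u in Set.Ioi (0 : ℝ), M u := by
      rw [← MeasureTheory.integral_add hFi hMi]
      refine MeasureTheory.integral_congr_ae (Eventually.of_forall fun u => ?_)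
      simp only [hF, hM]; ring
    have hMv : ∫ u in Set.Ioi (0 : ℝ), M u = c * ((1 / (s : ℂ)) ^ (κ + 1) *
        Complex.Gamma (κ + 1)) := by
      rw [← Complex.integral_cpow_mul_exp_neg_mul_Ioi (a := κ + 1) (by simp; linarith) hs,
        ← MeasureTheory.integral_const_mul]
      refine MeasureTheory.integral_congr_ae (Eventually.of_forall fun u => ?_)
      simp only [hM, add_sub_cancel_right]
      push_cast
      ring
    have hcancel : (s : ℂ) ^ κ * ((s : ℂ) * (1 / (s : ℂ)) ^ (κ + 1)) = 1 := by
      rw [one_div, Complex.inv_cpow _ _ (by rw [Complex.arg_ofReal_of_nonneg hs.le]; exact Real.pi_pos.ne),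
        Complex.cpow_add _ _ hsc, Complex.cpow_one, ← mul_assoc, mul_inv_cancel₀]
      exact mul_ne_zero (by simp [Complex.cpow_eq_zero_iff, hsc]) hsc
    have heq : (s : ℂ) ^ κ * ((s : ℂ) * ∫ u in Set.Ioi (0 : ℝ), expSum a u *
        (Real.exp (-(s * u)) : ℂ)) - c * Complex.Gamma (κ + 1) =
        (s : ℂ) ^ κ * s * ∫ u in Set.Ioi (0 : ℝ), F u := by
      rw [hsplit, hMv]
      linear_combination (c * Complex.Gamma (κ + 1)) * hcancel
    have hGv : ∫ u in Set.Ioi (0 : ℝ), G u =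
        K1 * ((1 / s) ^ b * Real.Gamma b + (1 / s) ^ m * Real.Gamma m) := by
      rw [hG, MeasureTheory.integral_const_mul, MeasureTheory.integral_add
        (integrableOn_rpow_sub_one_mul_exp hb0 hs) (integrableOn_rpow_sub_one_mul_exp hm0 hs),
        Real.integral_rpow_mul_exp_neg_mul_Ioi hb0 hs, Real.integral_rpow_mul_exp_neg_mul_Ioi hm0 hs]
    have hs1 : ∀ e : ℝ, s ^ (κ.re + 1 - e) = s ^ κ.re * s * (1 / s) ^ e := by
      intro e
      rw [one_div, Real.inv_rpow hs.le, Real.rpow_sub hs, Real.rpow_add hs, Real.rpow_one,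
        div_eq_mul_inv]
    rw [heq, norm_mul, norm_mul, Complex.norm_cpow_eq_rpow_re_of_pos hs, Complex.norm_real,
      Real.norm_eq_abs, abs_of_pos hs]
    calc s ^ κ.re * s * ‖∫ u in Set.Ioi (0 : ℝ), F u‖
        ≤ s ^ κ.re * s * ∫ u in Set.Ioi (0 : ℝ), G u := by
          gcongr
          exact MeasureTheory.norm_integral_le_of_norm_le hGi hFG
      _ = _ := by rw [hGv, hs1, hs1]; ring
  rw [tendsto_iff_norm_sub_tendsto_zero]
  have hz : ∀ e : ℝ, 0 < e → Tendsto (fun s : ℝ => s ^ e) (nhdsWithin 0 (Set.Ioi 0)) (nhds 0) := by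
    intro e he
    have := (Real.continuousAt_rpow_const 0 e (Or.inr he.le)).tendsto
    rw [Real.zero_rpow he.ne'] at this
    exact this.mono_left nhdsWithin_le_nhds
  have hlim : Tendsto (fun s : ℝ => K1 * (s ^ (κ.re + 1 - b) * Real.Gamma b +
      s ^ (κ.re + 1 - m) * Real.Gamma m)) (nhdsWithin 0 (Set.Ioi 0)) (nhds 0) := by
    have := (((hz _ (sub_pos.2 hb2)).mul_const (Real.Gamma b)).add
      ((hz _ (sub_pos.2 hm1)).mul_const (Real.Gamma m))).const_mul K1
    simpa using this
  refine squeeze_zero' (Eventually.of_forall fun s => norm_nonneg _) ?_ hlim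
  filter_upwards [self_mem_nhdsWithin] with s hs
  exact hbound s hs

theorem MeanValueBounds.isBigO_sum_norm {a : ℕ → ℂ} {κ : ℂ} {β A B P D : ℝ}
    (h : MeanValueBounds a κ β A B P D) {s : ℝ} (hs : 0 < s) :
    (fun n => ∑ k ∈ Icc 1 n, ‖a k‖) =O[atTop] fun n : ℕ => (n : ℝ) ^ s := by
  have h1 : (fun n : ℕ => ∑ k ∈ Icc 1 n, ‖a k‖) =O[atTop] fun n : ℕ => Real.log n ^ β := by
    refine Asymptotics.IsBigO.of_bound (|P * Real.exp B|) ?_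
    filter_upwards [eventually_ge_atTop 2] with n hn
    have h2 : (2 : ℝ) ≤ n := by exact_mod_cast hn
    have := h.sum_norm_le h2
    rw [Nat.floor_natCast] at this
    rw [Real.norm_of_nonneg (sum_nonneg fun _ _ => norm_nonneg _), Real.norm_of_nonneg
      (Real.rpow_nonneg (Real.log_nonneg (by linarith)) _)]
    refine this.trans ?_
    exact mul_le_mul_of_nonneg_right (le_abs_self _)
      (Real.rpow_nonneg (Real.log_nonneg (by linarith)) _)
  exact h1.trans ((isLittleO_log_rpow_rpow_atTop β hs).isBigO.comp_tendsto
    tendsto_natCast_atTop_atTop)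

theorem prod_ofReal_cpow {ι : Type*} (s : Finset ι) (f : ι → ℝ) (hf : ∀ i ∈ s, 0 ≤ f i) (κ : ℂ) :
    ∏ i ∈ s, ((f i : ℝ) : ℂ) ^ κ = ((∏ i ∈ s, f i : ℝ) : ℂ) ^ κ := by
  classical
  induction s using Finset.induction_on with
  | empty => simp
  | insert i s hi ih =>
    rw [prod_insert hi, prod_insert hi, ih fun j hj => hf j (mem_insert_of_mem hj),
      Complex.ofReal_mul, Complex.mul_cpow_ofReal_nonneg (hf i (mem_insert_self i s))
        (prod_nonneg fun j hj => hf j (mem_insert_of_mem hj))]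

theorem exists_pos_riemannZeta_one_add {s : ℝ} (hs : 0 < s) :
    ∃ r : ℝ, 0 < r ∧ riemannZeta (1 + s) = r := by
  have h1 : (1 : ℝ) < ((1 : ℂ) + s).re := by simpa using hs
  have hsum : Summable fun n : ℕ => 1 / (n : ℝ) ^ (1 + s) :=
    Real.summable_one_div_nat_rpow.2 (by linarith)
  refine ⟨∑' n : ℕ, 1 / (n : ℝ) ^ (1 + s), ?_, ?_⟩
  · exact hsum.tsum_pos (fun n => by positivity) 1 (by simp)
  · rw [zeta_eq_tsum_one_div_nat_cpow h1, Complex.ofReal_tsum]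
    refine tsum_congr fun n => ?_
    rw [Complex.ofReal_div, Complex.ofReal_cpow n.cast_nonneg]
    push_cast
    rfl

theorem one_sub_rpow_neg_pos {p : ℕ} (hp : p.Prime) {s : ℝ} (hs : 0 ≤ s) :
    0 < 1 - (p : ℝ) ^ (-(1 + s)) :=
  sub_pos.2 (Real.rpow_lt_one_of_one_lt_of_neg (by exact_mod_cast hp.one_lt) (by linarith))

theorem tendsto_prod_one_sub_cpow {s : ℝ} (hs : 0 < s) (κ : ℂ) :
    Tendsto (fun n : ℕ => ∏ p ∈ n.primesBelow, ((1 - (p : ℝ) ^ (-(1 + s)) : ℝ) : ℂ) ^ κ) atTop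
      (nhds ((riemannZeta (1 + s))⁻¹ ^ κ)) := by
  obtain ⟨r, hr, hζ⟩ := exists_pos_riemannZeta_one_add hs
  have h1 : (1 : ℝ) < ((1 : ℂ) + s).re := by simpa using hs
  have h2 := riemannZeta_eulerProduct h1
  rw [hζ] at h2 ⊢
  have hrc : (r : ℂ) ≠ 0 := by exact_mod_cast hr.ne'
  have h3 := (h2.inv₀ hrc)
  have hslit : (r : ℂ)⁻¹ ∈ Complex.slitPlane := by
    rw [← Complex.ofReal_inv]
    exact Complex.ofReal_mem_slitPlane.2 (inv_pos.2 hr)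
  have h4 := ((continuousAt_id.cpow continuousAt_const hslit :
    ContinuousAt (fun z : ℂ => z ^ κ) ((r : ℂ)⁻¹)).tendsto).comp h3
  refine h4.congr fun n => ?_
  rw [prod_ofReal_cpow _ _ fun p hp => (one_sub_rpow_neg_pos (Nat.prime_of_mem_primesBelow hp)
    hs.le).le, Function.comp, ← prod_inv_distrib]
  congr 1
  push_cast
  refine prod_congr rfl fun p _ => ?_
  rw [inv_inv, Complex.ofReal_cpow p.cast_nonneg]
  push_cast
  rfl

theorem tendsto_inv_riemannZeta_cpow_mul {L : ℝ → ℂ} {κ l : ℂ}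
    (h : Tendsto (fun s : ℝ => (s : ℂ) ^ κ * L s) (nhdsWithin 0 (Set.Ioi 0)) (nhds l)) :
    Tendsto (fun s : ℝ => (riemannZeta (1 + s))⁻¹ ^ κ * L s) (nhdsWithin 0 (Set.Ioi 0))
      (nhds l) := by
  have h1 : Tendsto (fun s : ℝ => (1 : ℂ) + s) (nhdsWithin 0 (Set.Ioi 0))
      (nhdsWithin 1 {1}ᶜ) := by
    refine tendsto_nhdsWithin_iff.2 ⟨?_, ?_⟩
    · have : Continuous fun s : ℝ => (1 : ℂ) + s := by fun_prop
      have h0 := (this.tendsto 0).mono_left (nhdsWithin_le_nhds (s := Set.Ioi 0))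
      simpa using h0
    · filter_upwards [self_mem_nhdsWithin] with s hs
      have : s ≠ 0 := ne_of_gt hs
      simpa using this
  have h2 : Tendsto (fun s : ℝ => (s : ℂ) * riemannZeta (1 + s)) (nhdsWithin 0 (Set.Ioi 0))
      (nhds 1) := by
    refine (riemannZeta_residue_one.comp h1).congr fun s => ?_
    simp
  have h3 := h2.inv₀ one_ne_zero
  rw [inv_one] at h3
  have h4 := ((continuousAt_id.cpow continuousAt_const Complex.one_mem_slitPlane :
    ContinuousAt (fun z : ℂ => z ^ κ) 1).tendsto).comp h3
  have h5 := h4.mul h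
  simp only [Complex.one_cpow, id, one_mul] at h5
  refine h5.congr' ?_
  filter_upwards [self_mem_nhdsWithin] with s hs
  have hs : 0 < s := hs
  obtain ⟨r, hr, hζ⟩ := exists_pos_riemannZeta_one_add hs
  rw [Function.comp, hζ, ← mul_assoc]
  congr 1
  rw [← Complex.ofReal_mul, ← Complex.ofReal_inv, ← Complex.ofReal_inv,
    ← Complex.mul_cpow_ofReal_nonneg (by positivity) hs.le, ← Complex.ofReal_mul]
  congr 2
  field_simp

/-- The factor `∑ a (p ^ r) p ^ (-r s)` at `p` of the Euler product of `LSeries a`. -/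
noncomputable def eulerFactor (a : ℕ → ℂ) (p : ℕ) (s : ℝ) : ℂ :=
  ∑' r : ℕ, LSeries.term a s (p ^ r)

namespace MeanValueBounds

variable {a : ℕ → ℂ} {κ : ℂ} {β A B P D : ℝ}

theorem tendsto_prod_eulerFactor (h : MeanValueBounds a κ β A B P D) {s : ℝ} (hs : 0 < s) :
    Tendsto (fun n : ℕ => ∏ p ∈ n.primesBelow, eulerFactor a p s) atTop
      (nhds (LSeries a s)) := by
  have hsum : LSeriesSummable a s :=
    LSeriesSummable_of_sum_norm_bigO (h.isBigO_sum_norm (half_pos hs)) (by positivity)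
      (by simpa using hs)
  refine EulerProduct.eulerProduct (f := LSeries.term a s) ?_ ?_ hsum.norm ?_
  · rw [LSeries.term_of_ne_zero one_ne_zero, h.map_one]; simp
  · intro m n hmn
    rcases eq_or_ne m 0 with rfl | hm
    · simp
    rcases eq_or_ne n 0 with rfl | hn
    · simp
    rw [LSeries.term_of_ne_zero hm, LSeries.term_of_ne_zero hn,
      LSeries.term_of_ne_zero (mul_ne_zero hm hn), h.map_mul m n hmn, Nat.cast_mul,
      Complex.natCast_mul_natCast_cpow, mul_div_mul_comm]
  · exact LSeries.term_zero ..

theorem tendsto_prod_cpow_mul_eulerFactor (h : MeanValueBounds a κ β A B P D) {s : ℝ}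
    (hs : 0 < s) :
    Tendsto (fun n : ℕ => ∏ p ∈ n.primesBelow,
      ((1 - (p : ℝ) ^ (-(1 + s)) : ℝ) : ℂ) ^ κ * eulerFactor a p s) atTop
      (nhds ((riemannZeta (1 + s))⁻¹ ^ κ * LSeries a s)) := by
  simp only [prod_mul_distrib]
  exact (tendsto_prod_one_sub_cpow hs κ).mul (h.tendsto_prod_eulerFactor hs)

end MeanValueBounds

theorem abs_log_one_sub_add_le {y : ℝ} (hy0 : 0 ≤ y) (hy : y ≤ 1 / 2) :
    |Real.log (1 - y) + y| ≤ 2 * y ^ 2 := by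
  have h := Real.abs_log_sub_add_sum_range_le (x := y) (by rw [abs_of_nonneg hy0]; linarith) 1
  simp only [sum_range_one, abs_of_nonneg hy0] at h
  norm_num at h
  rw [add_comm]
  refine h.trans ?_
  rw [div_le_iff₀ (by linarith)]
  nlinarith [sq_nonneg y]

theorem norm_cpow_mul_exp_sub_one_le {κ z R : ℂ} {y : ℝ} (hy0 : 0 ≤ y) (hy : y ≤ 1 / 2)
    (hκ : 2 * ‖κ‖ * y ^ 2 ≤ 1) (hz : ‖z‖ ≤ 1) (hR : ‖R‖ ≤ 1) :
    ‖((1 - y : ℝ) : ℂ) ^ κ * Complex.exp (κ * y) * (1 + z + R) * Complex.exp (-z) - 1‖ ≤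
      28 * ‖κ‖ * y ^ 2 + 3 * (‖z‖ ^ 2 + ‖R‖) := by
  set X := ((1 - y : ℝ) : ℂ) ^ κ * Complex.exp (κ * y)
  set W := (1 + z + R) * Complex.exp (-z)
  have hX : ‖X - 1‖ ≤ 4 * ‖κ‖ * y ^ 2 := by
    have h1 : X = Complex.exp (((Real.log (1 - y) + y : ℝ) : ℂ) * κ) := by
      simp only [X]
      rw [Complex.cpow_def_of_ne_zero (by exact_mod_cast (by linarith : (0 : ℝ) < 1 - y).ne'),
        ← Complex.ofReal_log (by linarith), ← Complex.exp_add]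
      congr 1
      push_cast
      ring
    have h2 : ‖((Real.log (1 - y) + y : ℝ) : ℂ) * κ‖ ≤ 2 * ‖κ‖ * y ^ 2 := by
      rw [norm_mul, Complex.norm_real, Real.norm_eq_abs]
      calc _ ≤ 2 * y ^ 2 * ‖κ‖ := by gcongr; exact abs_log_one_sub_add_le hy0 hy
        _ = _ := by ring
    rw [h1]
    exact (Complex.norm_exp_sub_one_le (h2.trans hκ)).trans (by linarith)
  have hW : ‖W - 1‖ ≤ 3 * (‖z‖ ^ 2 + ‖R‖) := by
    have h1 : W - 1 = Complex.exp (-z) * (R - (Complex.exp z - 1 - z)) := by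
      have : Complex.exp (-z) * Complex.exp z = 1 := by rw [← Complex.exp_add]; simp
      simp only [W]
      linear_combination this
    have h2 : ‖Complex.exp (-z)‖ ≤ 3 := by
      refine (Complex.norm_exp_le_exp_norm _).trans ?_
      rw [norm_neg]
      refine (Real.exp_le_exp.2 hz).trans ?_
      linarith [Real.exp_one_lt_d9]
    have h3 := Complex.norm_exp_sub_one_sub_id_le hz
    rw [h1, norm_mul]
    calc _ ≤ 3 * (‖R‖ + ‖Complex.exp z - 1 - z‖) := by
          gcongr
          exact norm_sub_le _ _
      _ ≤ _ := by linarith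
  have hz2 : ‖z‖ ^ 2 ≤ 1 := pow_le_one₀ (norm_nonneg _) hz
  have hW' : ‖W‖ ≤ 7 := by
    have : ‖W‖ ≤ ‖W - 1‖ + 1 := by simpa using norm_add_le (W - 1) 1
    linarith
  have heq : X * (1 + z + R) * Complex.exp (-z) - 1 = (X - 1) * W + (W - 1) := by
    simp only [W]; ring
  rw [heq]
  calc ‖(X - 1) * W + (W - 1)‖ ≤ ‖X - 1‖ * ‖W‖ + ‖W - 1‖ := by
        rw [← norm_mul]; exact norm_add_le _ _
    _ ≤ (4 * ‖κ‖ * y ^ 2) * 7 + 3 * (‖z‖ ^ 2 + ‖R‖) := by gcongr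
    _ = _ := by ring

namespace MeanValueBounds

variable {a : ℕ → ℂ} {κ : ℂ} {β A B P D : ℝ}

theorem norm_term_pow_le (p r : ℕ) (hp : p.Prime) {s : ℝ} (hs : 0 ≤ s) :
    ‖LSeries.term a s (p ^ r)‖ ≤ ‖a (p ^ r)‖ := by
  have h0 : 0 < p ^ r := pow_pos hp.pos r
  rw [LSeries.norm_term_eq, if_neg h0.ne']
  refine div_le_self (norm_nonneg _) ?_
  simpa using Real.one_le_rpow (by exact_mod_cast h0) hs

theorem summable_term_pow (h : MeanValueBounds a κ β A B P D) {p : ℕ} (hp : p.Prime) {s : ℝ}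
    (hs : 0 ≤ s) : Summable fun r : ℕ => LSeries.term a s (p ^ r) :=
  Summable.of_norm_bounded (h.summable_norm_pow hp) fun r => norm_term_pow_le p r hp hs

theorem norm_eulerFactor_sub_le (h : MeanValueBounds a κ β A B P D) {p : ℕ} (hp : p.Prime) {s : ℝ}
    (hs : 0 ≤ s) :
    ‖eulerFactor a p s - (1 + a p * (((p : ℝ) ^ (-s) : ℝ) : ℂ))‖ ≤ ∑' r : ℕ, ‖a (p ^ (r + 2))‖ := by
  have h1 := (h.summable_term_pow hp hs).sum_add_tsum_nat_add 2
  have h2 : ∑ i ∈ range 2, LSeries.term a s (p ^ i) = 1 + a p * (((p : ℝ) ^ (-s) : ℝ) : ℂ) := by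
    rw [sum_range_succ, sum_range_one, pow_zero, pow_one, LSeries.term_of_ne_zero one_ne_zero,
      LSeries.term_of_ne_zero hp.ne_zero, h.map_one, Complex.ofReal_cpow p.cast_nonneg]
    push_cast
    rw [Complex.cpow_neg, div_eq_mul_inv, div_eq_mul_inv]
    simp
  rw [eulerFactor, ← h1, h2, add_sub_cancel_left]
  exact tsum_of_norm_bounded ((summable_nat_add_iff 2).2 (h.summable_norm_pow hp)).hasSum
    fun r => norm_term_pow_le p (r + 2) hp hs

theorem continuousOn_eulerFactor (h : MeanValueBounds a κ β A B P D) {p : ℕ} (hp : p.Prime) :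
    ContinuousOn (eulerFactor a p) (Set.Icc 0 1) := by
  refine continuousOn_tsum (u := fun r => ‖a (p ^ r)‖) (fun r => ?_) (h.summable_norm_pow hp)
    fun r s hs => norm_term_pow_le p r hp hs.1
  have h0 : ((p ^ r : ℕ) : ℂ) ≠ 0 := by exact_mod_cast (pow_pos hp.pos r).ne'
  simp only [LSeries.term_of_ne_zero (pow_pos hp.pos r).ne']
  refine ContinuousOn.div continuousOn_const ?_ fun s _ => by
    simp [Complex.cpow_eq_zero_iff, hp.ne_zero]
  exact (Continuous.const_cpow Complex.continuous_ofReal (Or.inl h0)).continuousOn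

theorem summable_norm_sq (h : MeanValueBounds a κ β A B P D) :
    Summable fun p : Nat.Primes => ‖a p‖ ^ 2 := by
  have hl : 0 < Real.log 2 := Real.log_pos (by norm_num)
  refine Summable.of_nonneg_of_le (fun p => sq_nonneg _) (fun p => ?_)
    (h.summable_cross.mul_left (1 / Real.log 2))
  have h1 : Real.log 2 ≤ Real.log (p : ℕ) :=
    Real.log_le_log (by norm_num) (by exact_mod_cast p.2.two_le)
  have h2 : ‖a p‖ ≤ ∑' r : ℕ, ‖a ((p : ℕ) ^ (r + 1))‖ := by
    have := (h.summable_pow p).le_tsum 0 fun _ _ => norm_nonneg _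
    simpa using this
  rw [one_div, ← div_eq_inv_mul, le_div_iff₀ hl]
  calc ‖a p‖ ^ 2 * Real.log 2 = ‖a p‖ * Real.log 2 * ‖a p‖ := by ring
    _ ≤ _ := by gcongr

theorem summable_tsum_pow_add_two (h : MeanValueBounds a κ β A B P D) :
    Summable fun p : Nat.Primes => ∑' r : ℕ, ‖a ((p : ℕ) ^ (r + 2))‖ :=
  Summable.of_nonneg_of_le (fun _ => tsum_nonneg fun _ => norm_nonneg _)
    (fun p => h.tsum_norm_pow_add_two_le p.2) h.summable_high

/-- The local factor at `p`, divided by `exp (a p p ^ (-s) - κ p ^ (-(1 + s)))`, minus `1`. -/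
noncomputable def correction (a : ℕ → ℂ) (κ : ℂ) (p : ℕ) (s : ℝ) : ℂ :=
  ((1 - (p : ℝ) ^ (-(1 + s)) : ℝ) : ℂ) ^ κ * Complex.exp (κ * (((p : ℝ) ^ (-(1 + s)) : ℝ) : ℂ)) *
    eulerFactor a p s * Complex.exp (-(a p * (((p : ℝ) ^ (-s) : ℝ) : ℂ))) - 1

theorem exp_mul_one_add_correction (p : ℕ) (s : ℝ) :
    Complex.exp (a p * (((p : ℝ) ^ (-s) : ℝ) : ℂ) - κ * (((p : ℝ) ^ (-(1 + s)) : ℝ) : ℂ)) *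
      (1 + correction a κ p s) =
    ((1 - (p : ℝ) ^ (-(1 + s)) : ℝ) : ℂ) ^ κ * eulerFactor a p s := by
  rw [correction]
  set z := a p * (((p : ℝ) ^ (-s) : ℝ) : ℂ)
  set y := κ * (((p : ℝ) ^ (-(1 + s)) : ℝ) : ℂ)
  have h1 : Complex.exp (z - y) * (Complex.exp y * Complex.exp (-z)) = 1 := by
    rw [← Complex.exp_add, ← Complex.exp_add, show z - y + (y + -z) = 0 by ring, Complex.exp_zero]
  linear_combination (((1 - (p : ℝ) ^ (-(1 + s)) : ℝ) : ℂ) ^ κ * eulerFactor a p s) * h1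

theorem continuousOn_rpow_neg {p : ℕ} (hp : p.Prime) (f : ℝ → ℝ) (hf : Continuous f) :
    ContinuousOn (fun s : ℝ => (((p : ℝ) ^ (f s) : ℝ) : ℂ)) (Set.Icc 0 1) := by
  have hp0 : (p : ℝ) ≠ 0 := by exact_mod_cast hp.ne_zero
  exact (Complex.continuous_ofReal.comp
    (continuous_const.rpow hf fun _ => Or.inl hp0)).continuousOn

theorem continuousOn_correction (h : MeanValueBounds a κ β A B P D) {p : ℕ} (hp : p.Prime) :
    ContinuousOn (correction a κ p) (Set.Icc 0 1) := by
  have h1 := continuousOn_rpow_neg hp (fun s => -(1 + s)) (by fun_prop)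
  have h2 := continuousOn_rpow_neg hp (fun s => -s) (by fun_prop)
  have h3 : ContinuousOn (fun s : ℝ => ((1 - (p : ℝ) ^ (-(1 + s)) : ℝ) : ℂ) ^ κ)
      (Set.Icc 0 1) := by
    refine ContinuousOn.cpow_const ?_ fun s hs =>
      Complex.ofReal_mem_slitPlane.2 (one_sub_rpow_neg_pos hp hs.1)
    push_cast
    exact continuousOn_const.sub h1
  exact (((h3.mul (continuousOn_const.mul h1).cexp).mul (h.continuousOn_eulerFactor hp)).mul
    (continuousOn_const.mul h2).neg.cexp).sub continuousOn_const

theorem norm_correction_le (h : MeanValueBounds a κ β A B P D) {p : ℕ} (hp : p.Prime)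
    (hsmall : 28 * ‖κ‖ * (1 / (p : ℝ) ^ 2) + 3 * (‖a p‖ ^ 2 + ∑' r : ℕ, ‖a (p ^ (r + 2))‖) ≤ 1)
    {s : ℝ} (hs : 0 ≤ s) :
    ‖correction a κ p s‖ ≤
      28 * ‖κ‖ * (1 / (p : ℝ) ^ 2) + 3 * (‖a p‖ ^ 2 + ∑' r : ℕ, ‖a (p ^ (r + 2))‖) := by
  set T := ∑' r : ℕ, ‖a (p ^ (r + 2))‖
  have hT0 : 0 ≤ T := tsum_nonneg fun _ => norm_nonneg _
  have hp2 : (2 : ℝ) ≤ p := by exact_mod_cast hp.two_le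
  have hp0 : (0 : ℝ) < p := by linarith
  have hy0 : 0 ≤ (p : ℝ) ^ (-(1 + s)) := by positivity
  have hy1 : (p : ℝ) ^ (-(1 + s)) ≤ 1 / p := by
    rw [one_div, ← Real.rpow_neg_one]
    exact Real.rpow_le_rpow_of_exponent_le (by linarith) (by linarith)
  have hy2 : ((p : ℝ) ^ (-(1 + s))) ^ 2 ≤ 1 / (p : ℝ) ^ 2 := by
    rw [← one_div_pow]; gcongr
  have hy3 : (p : ℝ) ^ (-(1 + s)) ≤ 1 / 2 :=
    hy1.trans (one_div_le_one_div_of_le (by norm_num) hp2)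
  set R := eulerFactor a p s - (1 + a p * (((p : ℝ) ^ (-s) : ℝ) : ℂ)) with hR
  have hRT : ‖R‖ ≤ T := h.norm_eulerFactor_sub_le hp hs
  have hz : ‖a p * (((p : ℝ) ^ (-s) : ℝ) : ℂ)‖ ≤ ‖a p‖ := by
    rw [norm_mul, Complex.norm_real, Real.norm_of_nonneg (by positivity)]
    refine mul_le_of_le_one_right (norm_nonneg _) ?_
    exact Real.rpow_le_one_of_one_le_of_nonpos (by linarith) (by linarith)
  have hk : 0 ≤ ‖κ‖ * (1 / (p : ℝ) ^ 2) := by positivity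
  have ha : ‖a p‖ ≤ 1 := by
    have := norm_nonneg (a p)
    nlinarith
  have hsq := sq_nonneg ‖a p‖
  have hy4 : ‖κ‖ * ((p : ℝ) ^ (-(1 + s))) ^ 2 ≤ ‖κ‖ * (1 / (p : ℝ) ^ 2) := by gcongr
  have key := norm_cpow_mul_exp_sub_one_le (κ := κ) (z := a p * (((p : ℝ) ^ (-s) : ℝ) : ℂ)) (R := R)
    hy0 hy3 (by nlinarith) (hz.trans ha) (by linarith)
  have he : 1 + a p * (((p : ℝ) ^ (-s) : ℝ) : ℂ) + R = eulerFactor a p s := by rw [hR]; ring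
  rw [he] at key
  refine key.trans ?_
  have hz2 : ‖a p * (((p : ℝ) ^ (-s) : ℝ) : ℂ)‖ ^ 2 ≤ ‖a p‖ ^ 2 := by gcongr
  nlinarith

theorem exists_tendsto_prod_correction (h : MeanValueBounds a κ β A B P D) :
    ∃ F : ℝ → ℂ, ContinuousOn F (Set.Icc 0 1) ∧ ∀ s ∈ Set.Icc (0 : ℝ) 1,
      Tendsto (fun n : ℕ => ∏ p ∈ n.primesBelow, (1 + correction a κ p s)) atTop (nhds (F s)) := by
  classical
  set U : ℕ → ℝ := fun p => 28 * ‖κ‖ * (1 / (p : ℝ) ^ 2) +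
    3 * (‖a p‖ ^ 2 + ∑' r : ℕ, ‖a (p ^ (r + 2))‖) with hU
  set u : ℕ → ℝ := Set.indicator {p | p.Prime} U with hu
  have hus : Summable u := by
    refine summable_subtype_iff_indicator.1 ?_
    have h1 : Summable fun p : Nat.Primes => 1 / ((p : ℕ) : ℝ) ^ 2 :=
      (Real.summable_one_div_nat_pow.2 (by norm_num : 1 < 2)).comp_injective
        Subtype.val_injective
    exact (h1.mul_left (28 * ‖κ‖)).add
      ((h.summable_norm_sq.add h.summable_tsum_pow_add_two).mul_left 3)
  set f : ℕ → ℝ → ℂ := fun p s => if p.Prime then correction a κ p s else 0 with hf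
  have hev : ∀ᶠ n : ℕ in atTop, ∀ s ∈ Set.Icc (0 : ℝ) 1, ‖f n s‖ ≤ u n := by
    filter_upwards [hus.tendsto_atTop_zero.eventually (ge_mem_nhds one_pos)] with n hn s hs
    by_cases hp : n.Prime
    · simp only [hf, if_pos hp]
      have hun : u n = U n := Set.indicator_of_mem (show n ∈ {p | p.Prime} from hp) U
      rw [hun] at hn ⊢
      exact h.norm_correction_le hp hn hs.1
    · simp only [hf, if_neg hp, norm_zero]
      rw [hu, Set.indicator_of_notMem (show n ∉ {p | p.Prime} from hp)]
  have hcont : ∀ n, ContinuousOn (f n) (Set.Icc 0 1) := by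
    intro n
    by_cases hp : n.Prime
    · simpa only [hf, if_pos hp] using h.continuousOn_correction hp
    · simpa only [hf, if_neg hp] using continuousOn_const
  have hprod := (hus.hasProdUniformlyOn_nat_one_add isCompact_Icc hev
    hcont).tendstoUniformlyOn_finsetRange
  refine ⟨_, hprod.continuousOn (Eventually.frequently (Eventually.of_forall fun n =>
    continuousOn_finsetProd _ fun i _ => continuousOn_const.add (hcont i))), fun s hs => ?_⟩
  refine (hprod.tendsto_at hs).congr fun n => ?_
  rw [Nat.primesBelow, prod_filter]
  refine prod_congr rfl fun p _ => ?_
  simp only [hf]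
  split_ifs <;> simp

end MeanValueBounds

theorem norm_sum_Ico_mul_le {b : ℕ → ℂ} {φ : ℕ → ℝ} {S : ℝ} {N m : ℕ} (hNm : N ≤ m)
    (hφ0 : ∀ k, N ≤ k → 0 ≤ φ k) (hφ : ∀ k, N ≤ k → φ (k + 1) ≤ φ k)
    (hS : ∀ n, ‖∑ k ∈ range n, b k‖ ≤ S) :
    ‖∑ k ∈ Ico N m, b k * (φ k : ℂ)‖ ≤ 2 * S * φ N := by
  have hU : ∀ n, N ≤ n → ‖∑ k ∈ Ico N n, b k‖ ≤ 2 * S := fun n hn => by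
    rw [sum_Ico_eq_sub _ hn]
    exact (norm_sub_le _ _).trans (by linarith [hS n, hS N])
  have key : ‖∑ k ∈ Ico N m, b k * (φ k : ℂ) - (∑ k ∈ Ico N m, b k) * (φ m : ℂ)‖ ≤
      2 * S * (φ N - φ m) := by
    induction m, hNm using Nat.le_induction with
    | base => simp
    | succ m hm ih =>
      have heq : ∑ k ∈ Ico N (m + 1), b k * (φ k : ℂ) -
          (∑ k ∈ Ico N (m + 1), b k) * (φ (m + 1) : ℂ) =
          (∑ k ∈ Ico N m, b k * (φ k : ℂ) - (∑ k ∈ Ico N m, b k) * (φ m : ℂ)) +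
          (∑ k ∈ Ico N (m + 1), b k) * ((φ m - φ (m + 1) : ℝ) : ℂ) := by
        rw [sum_Ico_succ_top hm, sum_Ico_succ_top hm]
        push_cast
        ring
      have h1 : 0 ≤ φ m - φ (m + 1) := by linarith [hφ m hm]
      rw [heq]
      refine (norm_add_le _ _).trans ?_
      rw [norm_mul _ ((φ m - φ (m + 1) : ℝ) : ℂ), Complex.norm_real, Real.norm_of_nonneg h1]
      have := mul_le_mul_of_nonneg_right (hU (m + 1) (by omega)) h1
      linarith
  have h2 : ‖(∑ k ∈ Ico N m, b k) * (φ m : ℂ)‖ ≤ 2 * S * φ m := by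
    rw [norm_mul, Complex.norm_real, Real.norm_of_nonneg (hφ0 m hNm)]
    exact mul_le_mul_of_nonneg_right (hU m hNm) (hφ0 m hNm)
  have h3 := norm_add_le (∑ k ∈ Ico N m, b k * (φ k : ℂ) - (∑ k ∈ Ico N m, b k) * (φ m : ℂ))
    ((∑ k ∈ Ico N m, b k) * (φ m : ℂ))
  rw [sub_add_cancel] at h3
  linarith

namespace MeanValueBounds

variable {a : ℕ → ℂ} {κ : ℂ} {β A B P D : ℝ}

theorem exists_norm_sum_primesBelow_le (h : MeanValueBounds a κ β A B P D) :
    ∃ S : ℝ, ∀ n : ℕ, ‖∑ p ∈ n.primesBelow, (a p - κ / p) * (Real.log p : ℂ)‖ ≤ S := by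
  obtain ⟨C, hC⟩ := exists_abs_sum_log_div_prime_sub_log_le
  have hC0 : 0 ≤ C := (abs_nonneg _).trans (hC 1 le_rfl)
  have hD0 : 0 ≤ D := (norm_nonneg _).trans (h.mertens 2 le_rfl)
  refine ⟨D + ‖κ‖ * C, fun n => ?_⟩
  rcases le_or_gt n 2 with hn | hn
  · have : n.primesBelow = ∅ := by
      rw [Nat.primesBelow, filter_eq_empty_iff]
      intro p hp hpp
      have := hpp.two_le
      rw [mem_range] at hp
      omega
    rw [this, sum_empty, norm_zero]
    positivity
  · obtain ⟨N, rfl⟩ : ∃ N, n = N + 1 := ⟨n - 1, by omega⟩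
    have h1 := h.mertens N (by exact_mod_cast (by omega : 2 ≤ N))
    rw [Nat.floor_natCast] at h1
    have h2 := hC N (by omega)
    have heq : ∑ p ∈ (N + 1).primesBelow, (a p - κ / p) * (Real.log p : ℂ) =
        (∑ p ∈ (range (N + 1)).filter Nat.Prime, a p * (Real.log p : ℂ) - κ * (Real.log N : ℂ)) -
        κ * ((∑ p ∈ (range (N + 1)).filter Nat.Prime, Real.log p / p - Real.log N : ℝ) : ℂ) := by
      rw [Nat.primesBelow]
      push_cast
      rw [mul_sub, mul_sum, sub_sub_sub_cancel_right, ← sum_sub_distrib]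
      refine sum_congr rfl fun p _ => ?_
      ring
    rw [heq]
    refine (norm_sub_le _ _).trans ?_
    rw [norm_mul, Complex.norm_real, Real.norm_eq_abs]
    gcongr

theorem exists_tendsto_sum_primesBelow (h : MeanValueBounds a κ β A B P D) :
    ∃ F : ℝ → ℂ, ContinuousOn F (Set.Icc 0 1) ∧ ∀ s ∈ Set.Icc (0 : ℝ) 1,
      Tendsto (fun n : ℕ => ∑ p ∈ n.primesBelow,
        (a p * (((p : ℝ) ^ (-s) : ℝ) : ℂ) - κ * (((p : ℝ) ^ (-(1 + s)) : ℝ) : ℂ)))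
        atTop (nhds (F s)) := by
  obtain ⟨S, hS⟩ := h.exists_norm_sum_primesBelow_le
  set T : ℕ → ℝ → ℂ := fun n s => ∑ p ∈ n.primesBelow,
    (a p * (((p : ℝ) ^ (-s) : ℝ) : ℂ) - κ * (((p : ℝ) ^ (-(1 + s)) : ℝ) : ℂ)) with hT
  have hS0 : 0 ≤ S := (norm_nonneg _).trans (hS 0)
  set b : ℕ → ℂ := fun p => if p.Prime then (a p - κ / p) * (Real.log p : ℂ) else 0 with hb
  have hbS : ∀ n, ‖∑ k ∈ range n, b k‖ ≤ S := fun n => by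
    simpa only [hb, ← sum_filter, Nat.primesBelow] using hS n
  have hTb : ∀ n s, T n s = ∑ k ∈ range n, b k * (((k : ℝ) ^ (-s) / Real.log k : ℝ) : ℂ) := by
    intro n s
    simp only [hT, hb, Nat.primesBelow, sum_filter, ite_mul, zero_mul]
    refine sum_congr rfl fun p _ => ?_
    split_ifs with hp
    · have hp0 : (0 : ℝ) < p := by exact_mod_cast hp.pos
      have hl : (Real.log p : ℂ) ≠ 0 := by
        exact_mod_cast (Real.log_pos (by exact_mod_cast hp.one_lt)).ne'
      have hpc : (p : ℂ) ≠ 0 := by exact_mod_cast hp.ne_zero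
      rw [neg_add, Real.rpow_add hp0, Real.rpow_neg_one, Complex.ofReal_mul,
        Complex.ofReal_div, Complex.ofReal_inv, Complex.ofReal_natCast]
      field_simp
    · rfl
  have hbound : ∀ N n : ℕ, 2 ≤ N → N ≤ n → ∀ s ∈ Set.Icc (0 : ℝ) 1,
      ‖T n s - T N s‖ ≤ 2 * S / Real.log N := by
    intro N n hN hn s hs
    have hlog : ∀ k : ℕ, N ≤ k → 0 < Real.log k := fun k hk =>
      Real.log_pos (by exact_mod_cast (by omega : 1 < k))
    rw [hTb, hTb, ← sum_Ico_eq_sub _ hn]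
    refine (norm_sum_Ico_mul_le hn (fun k hk => ?_) (fun k hk => ?_) hbS).trans ?_
    · have := hlog k hk
      positivity
    · have h1 := hlog k hk
      have hk0 : (0 : ℝ) < k := by exact_mod_cast (by omega : 0 < k)
      have hk1 : (k : ℝ) ≤ ((k + 1 : ℕ) : ℝ) := by exact_mod_cast Nat.le_succ k
      have h2 : ((k + 1 : ℕ) : ℝ) ^ (-s) ≤ (k : ℝ) ^ (-s) :=
        Real.rpow_le_rpow_of_nonpos hk0 hk1 (by linarith [hs.1])
      have h3 : Real.log k ≤ Real.log ((k + 1 : ℕ) : ℝ) := Real.log_le_log hk0 hk1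
      gcongr
    · have h1 := hlog N le_rfl
      rw [mul_div_assoc' (2 * S)]
      refine div_le_div_of_nonneg_right (mul_le_of_le_one_right (by positivity) ?_) h1.le
      exact Real.rpow_le_one_of_one_le_of_nonpos (by exact_mod_cast (by omega : 1 ≤ N))
        (by linarith [hs.1])
  have hlim0 : Tendsto (fun N : ℕ => 2 * S / Real.log N) atTop (nhds 0) :=
    tendsto_const_nhds.div_atTop (Real.tendsto_log_atTop.comp tendsto_natCast_atTop_atTop)
  have hcauchy : UniformCauchySeqOn T atTop (Set.Icc 0 1) := by
    rw [Metric.uniformCauchySeqOn_iff]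
    intro ε hε
    obtain ⟨N, hN1, hN2⟩ := ((hlim0.eventually (gt_mem_nhds (half_pos hε))).and
      (eventually_ge_atTop 2)).exists
    refine ⟨N, fun m hm n hn s hs => ?_⟩
    have h1 := hbound N m hN2 hm s hs
    have h2 := hbound N n hN2 hn s hs
    rw [← dist_eq_norm] at h1 h2
    have h3 := dist_triangle_right (T m s) (T n s) (T N s)
    linarith
  have hpt : ∀ s ∈ Set.Icc (0 : ℝ) 1, ∃ l, Tendsto (fun n => T n s) atTop (nhds l) :=
    fun s hs => cauchySeq_tendsto_of_complete (hcauchy.cauchySeq hs)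
  classical
  set F : ℝ → ℂ := fun s => if hs : s ∈ Set.Icc (0 : ℝ) 1 then (hpt s hs).choose else 0 with hF
  have hFt : ∀ s ∈ Set.Icc (0 : ℝ) 1, Tendsto (fun n => T n s) atTop (nhds (F s)) := by
    intro s hs
    simp only [hF, dif_pos hs]
    exact (hpt s hs).choose_spec
  refine ⟨F, (hcauchy.tendstoUniformlyOn_of_tendsto hFt).continuousOn
    (Eventually.frequently (Eventually.of_forall fun n => ?_)), hFt⟩
  refine continuousOn_finsetSum _ fun p hp => ?_
  have hp := Nat.prime_of_mem_primesBelow hp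
  exact (continuousOn_const.mul (continuousOn_rpow_neg hp (fun s => -s) (by fun_prop))).sub
    (continuousOn_const.mul (continuousOn_rpow_neg hp (fun s => -(1 + s)) (by fun_prop)))

theorem exists_tendsto_prod_cpow_mul_tsum (h : MeanValueBounds a κ β A B P D) :
    ∃ Q : ℝ → ℂ, ContinuousOn Q (Set.Icc 0 1) ∧ ∀ s ∈ Set.Icc (0 : ℝ) 1,
      Tendsto (fun n : ℕ => ∏ p ∈ n.primesBelow,
        ((1 - (p : ℝ) ^ (-(1 + s)) : ℝ) : ℂ) ^ κ * eulerFactor a p s) atTop (nhds (Q s)) := by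
  obtain ⟨F, hF, hFt⟩ := h.exists_tendsto_sum_primesBelow
  obtain ⟨G, hG, hGt⟩ := h.exists_tendsto_prod_correction
  refine ⟨fun s => Complex.exp (F s) * G s, hF.cexp.mul hG, fun s hs => ?_⟩
  refine ((hFt s hs).cexp.mul (hGt s hs)).congr fun n => ?_
  rw [Complex.exp_sum, ← prod_mul_distrib]
  exact prod_congr rfl fun p _ => exp_mul_one_add_correction p s

theorem tendsto_prod_cpow_mul_tsum (h : MeanValueBounds a κ β A B P D) {c : ℂ} {K : ℝ}
    (hK : 0 ≤ K) (hβ0 : 0 ≤ β) (hβ : β < κ.re + 1)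
    (hc : ∀ t, Real.log 2 ≤ t → ‖expSum a t - c * (t : ℂ) ^ κ‖ ≤ K * t ^ (β - 1)) :
    Tendsto (fun n : ℕ => ∏ p ∈ n.primesBelow, (1 - 1 / (p : ℂ)) ^ κ * ∑' r : ℕ, a (p ^ r))
      atTop (nhds (Complex.Gamma (κ + 1) * c)) := by
  obtain ⟨Q, hQ, hQt⟩ := h.exists_tendsto_prod_cpow_mul_tsum
  have h1 := tendsto_inv_riemannZeta_cpow_mul
    (tendsto_cpow_mul_lSeries h.map_one hK hβ0 hβ (fun s hs => h.isBigO_sum_norm hs) hc)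
  have h2 : Tendsto Q (nhdsWithin 0 (Set.Ioi 0)) (nhds (Q 0)) := by
    have : Tendsto Q (nhdsWithin 0 (Set.Icc 0 1)) (nhds (Q 0)) := hQ 0 (by simp)
    refine this.mono_left (nhdsWithin_le_of_mem ?_)
    exact mem_of_superset (Ioc_mem_nhdsGT one_pos) Set.Ioc_subset_Icc_self
  have h3 : Q 0 = Complex.Gamma (κ + 1) * c := by
    rw [mul_comm]
    refine tendsto_nhds_unique (h2.congr' ?_) h1
    filter_upwards [Ioc_mem_nhdsGT one_pos] with s hs
    exact tendsto_nhds_unique (hQt s ⟨hs.1.le, hs.2⟩) (h.tendsto_prod_cpow_mul_eulerFactor hs.1)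
  rw [← h3]
  refine (hQt 0 (by simp)).congr fun n => prod_congr rfl fun p hp => ?_
  have hp := Nat.prime_of_mem_primesBelow hp
  congr 1
  · rw [add_zero, Real.rpow_neg_one]
    push_cast
    rw [one_div]
  · rw [eulerFactor]
    refine tsum_congr fun r => ?_
    rw [LSeries.term_of_ne_zero (pow_pos hp.pos r).ne']
    simp

end MeanValueBounds

/-- The function `n ↦ g n / n` restricted to the integers coprime to `Q`. -/
noncomputable def coprimeRestrict (g : ℕ → ℂ) (Q n : ℕ) : ℂ :=
  if Nat.Coprime n Q then g n / (n : ℂ) else 0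

theorem coprimeRestrict_prime_pow_of_not_dvd (g : ℕ → ℂ) {Q p : ℕ} (hp : p.Prime) (h : ¬ p ∣ Q)
    (r : ℕ) : coprimeRestrict g Q (p ^ r) = g (p ^ r) / (p : ℂ) ^ r := by
  rw [coprimeRestrict, if_pos (Nat.Coprime.pow_left r ((Nat.Prime.coprime_iff_not_dvd hp).2 h)),
    Nat.cast_pow]

theorem coprimeRestrict_prime_pow_of_dvd (g : ℕ → ℂ) {Q p : ℕ} (hp : p.Prime) (h : p ∣ Q)
    {r : ℕ} (hr : r ≠ 0) : coprimeRestrict g Q (p ^ r) = 0 := by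
  rw [coprimeRestrict, if_neg]
  rw [Nat.coprime_pow_left_iff (Nat.pos_of_ne_zero hr), Nat.Prime.coprime_iff_not_dvd hp]
  exact not_not.2 h

theorem norm_coprimeRestrict_le (g : ℕ → ℂ) (Q n : ℕ) :
    ‖coprimeRestrict g Q n‖ ≤ ‖g n‖ / n := by
  rw [coprimeRestrict]
  split_ifs
  · simp
  · rw [norm_zero]; positivity

theorem norm_coprimeRestrict_pow_le (g : ℕ → ℂ) (Q p r : ℕ) :
    ‖coprimeRestrict g Q (p ^ r)‖ ≤ ‖g (p ^ r)‖ / (p : ℝ) ^ r := by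
  simpa using norm_coprimeRestrict_le g Q (p ^ r)

theorem norm_sum_coprimeRestrict_sub_le (g : ℕ → ℂ) {Q : ℕ} (hQ : Q ≠ 0) (s : Finset ℕ) :
    ‖∑ p ∈ s.filter Nat.Prime, coprimeRestrict g Q p * (Real.log p : ℂ) -
      ∑ p ∈ s.filter Nat.Prime, g p * (Real.log p : ℂ) / (p : ℂ)‖ ≤
      ∑ p ∈ Q.primeFactors, ‖g p‖ * Real.log p / p := by
  have hnn : ∀ p : ℕ, 0 ≤ ‖g p‖ * Real.log p / p := fun p => by
    have := Real.log_natCast_nonneg p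
    positivity
  rw [← sum_sub_distrib]
  calc _ ≤ ∑ p ∈ s.filter Nat.Prime, if p ∣ Q then ‖g p‖ * Real.log p / p else 0 := by
        refine norm_sum_le_of_le _ fun p hp => ?_
        have hp := (mem_filter.1 hp).2
        split_ifs with h
        · have := coprimeRestrict_prime_pow_of_dvd g hp h one_ne_zero
          rw [pow_one] at this
          rw [this, zero_mul, zero_sub, norm_neg, norm_div, norm_mul, Complex.norm_real,
            Real.norm_of_nonneg (Real.log_natCast_nonneg p), Complex.norm_natCast]
        · have := coprimeRestrict_prime_pow_of_not_dvd g hp h 1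
          rw [pow_one, pow_one] at this
          rw [this, div_mul_eq_mul_div, sub_self, norm_zero]
    _ = ∑ p ∈ (s.filter Nat.Prime).filter (· ∣ Q), ‖g p‖ * Real.log p / p := by
        rw [sum_filter (· ∣ Q)]
    _ ≤ _ := by
        refine sum_le_sum_of_subset_of_nonneg (fun p hp => ?_) fun p _ _ => hnn p
        rw [mem_filter, mem_filter] at hp
        exact Nat.mem_primeFactors.2 ⟨hp.1.2, hp.2, hQ⟩

theorem totient_div_cpow_eq_prod {Q : ℕ} (hQ : Q ≠ 0) (κ : ℂ) :
    ((Q.totient : ℂ) / (Q : ℂ)) ^ κ = ∏ p ∈ Q.primeFactors, (1 - 1 / (p : ℂ)) ^ κ := by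
  have h1 : ∀ p ∈ Q.primeFactors, (0 : ℝ) ≤ 1 - 1 / (p : ℝ) := fun p hp => by
    have : (1 : ℝ) ≤ p := by exact_mod_cast (Nat.prime_of_mem_primeFactors hp).one_lt.le
    rw [sub_nonneg]
    exact div_le_one_of_le₀ this (by linarith)
  have h2 : (Q.totient : ℝ) / Q = ∏ p ∈ Q.primeFactors, (1 - 1 / (p : ℝ)) := by
    have hQ' : (Q : ℝ) ≠ 0 := by exact_mod_cast hQ
    have h3 := congrArg (fun x : ℚ => (x : ℝ)) (Nat.totient_eq_mul_prod_factors Q)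
    push_cast at h3
    rw [h3, mul_div_cancel_left₀ _ hQ']
    simp
  have h4 := prod_ofReal_cpow _ _ h1 κ
  rw [← h2] at h4
  push_cast at h4
  exact h4.symm

theorem prod_coprimeRestrict_eq {g : ℕ → ℂ} (hg1 : g 1 = 1) {Q : ℕ} (hQ : Q ≠ 0) {N : ℕ}
    (hN : Q < N) (κ : ℂ) :
    ∏ p ∈ N.primesBelow, (1 - 1 / (p : ℂ)) ^ κ * ∑' r : ℕ, coprimeRestrict g Q (p ^ r) =
      ((Q.totient : ℂ) / (Q : ℂ)) ^ κ *
        ∏ p ∈ (range N).filter (fun p => p.Prime ∧ ¬ p ∣ Q),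
          (1 - 1 / (p : ℂ)) ^ κ * ∑' r : ℕ, g (p ^ r) / ((p : ℂ) ^ r) := by
  rw [← prod_filter_mul_prod_filter_not N.primesBelow (· ∣ Q), totient_div_cpow_eq_prod hQ]
  congr 1
  · have hset : N.primesBelow.filter (· ∣ Q) = Q.primeFactors := by
      ext p
      simp only [mem_filter, Nat.mem_primesBelow, Nat.mem_primeFactors]
      constructor
      · rintro ⟨⟨_, hp⟩, hd⟩
        exact ⟨hp, hd, hQ⟩
      · rintro ⟨hp, hd, _⟩
        exact ⟨⟨(Nat.le_of_dvd (Nat.pos_of_ne_zero hQ) hd).trans_lt hN, hp⟩, hd⟩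
    rw [hset]
    refine prod_congr rfl fun p hp => ?_
    rw [tsum_eq_single 0 fun r hr => coprimeRestrict_prime_pow_of_dvd g
      (Nat.prime_of_mem_primeFactors hp) (Nat.dvd_of_mem_primeFactors hp) hr]
    simp [coprimeRestrict, hg1]
  · have hset : N.primesBelow.filter (fun p => ¬ p ∣ Q) =
        (range N).filter (fun p => p.Prime ∧ ¬ p ∣ Q) := by
      rw [Nat.primesBelow, filter_filter]
    rw [hset]
    refine prod_congr rfl fun p hp => ?_
    obtain ⟨-, hp, hd⟩ := mem_filter.1 hp
    simp only [coprimeRestrict_prime_pow_of_not_dvd g hp hd]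

theorem meanValueBounds_coprimeRestrict {g : ℕ → ℂ} (hg1 : g 1 = 1)
    (hmul : ∀ m n : ℕ, Nat.Coprime m n → g (m * n) = g m * g n) {κ : ℂ} {β C P : ℝ}
    (hmertens : ∀ w : ℝ, 2 ≤ w →
      ‖(∑ p ∈ (range (⌊w⌋₊ + 1)).filter Nat.Prime,
          g p * (Real.log p : ℂ) / (p : ℂ)) - κ * (Real.log w : ℂ)‖ ≤ C)
    (hinner1 : ∀ p : Nat.Primes,
      Summable (fun r : ℕ => ‖g ((p : ℕ) ^ (r + 1))‖ / ((p : ℕ) : ℝ) ^ (r + 1)))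
    (hsum1 : Summable (fun p : Nat.Primes =>
      ‖g (p : ℕ)‖ * Real.log (p : ℕ) / (p : ℕ) *
        ∑' r : ℕ, ‖g ((p : ℕ) ^ (r + 1))‖ / ((p : ℕ) : ℝ) ^ (r + 1)))
    (hinner2 : ∀ p : Nat.Primes, Summable (fun r : ℕ =>
      ‖g ((p : ℕ) ^ (r + 2))‖ * Real.log (((p : ℕ) : ℝ) ^ (r + 2)) / ((p : ℕ) : ℝ) ^ (r + 2)))
    (hsum2 : Summable (fun p : Nat.Primes =>
      ∑' r : ℕ, ‖g ((p : ℕ) ^ (r + 2))‖ * Real.log (((p : ℕ) : ℝ) ^ (r + 2)) /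
        ((p : ℕ) : ℝ) ^ (r + 2)))
    (hprod : ∀ x : ℝ, 2 ≤ x →
      ∏ p ∈ (range (⌊x⌋₊ + 1)).filter Nat.Prime, (1 + ‖g p‖ / p) ≤ P * Real.log x ^ β)
    {Q : ℕ} (hQ : Q ≠ 0) :
    MeanValueBounds (coprimeRestrict g Q) κ β
      (∑' p : Nat.Primes, ‖g (p : ℕ)‖ * Real.log (p : ℕ) / (p : ℕ) *
        ∑' r : ℕ, ‖g ((p : ℕ) ^ (r + 1))‖ / ((p : ℕ) : ℝ) ^ (r + 1))
      (∑' p : Nat.Primes, ∑' r : ℕ, ‖g ((p : ℕ) ^ (r + 2))‖ *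
        Real.log (((p : ℕ) : ℝ) ^ (r + 2)) / ((p : ℕ) : ℝ) ^ (r + 2))
      P (C + ∑ p ∈ Q.primeFactors, ‖g p‖ * Real.log p / p) := by
  have hlog : ∀ p r : ℕ, 0 ≤ Real.log ((p : ℝ) ^ r) := fun p r => by
    exact_mod_cast Real.log_natCast_nonneg (p ^ r)
  have hpow : ∀ p : Nat.Primes, Summable fun r : ℕ =>
      ‖coprimeRestrict g Q ((p : ℕ) ^ (r + 1))‖ := fun p =>
    Summable.of_nonneg_of_le (fun _ => norm_nonneg _)
      (fun r => norm_coprimeRestrict_pow_le g Q p (r + 1)) (hinner1 p)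
  have hcross0 : ∀ p : Nat.Primes, 0 ≤ ‖coprimeRestrict g Q (p : ℕ)‖ * Real.log (p : ℕ) *
      ∑' r : ℕ, ‖coprimeRestrict g Q ((p : ℕ) ^ (r + 1))‖ := fun p =>
    mul_nonneg (mul_nonneg (norm_nonneg _) (Real.log_natCast_nonneg _))
      (tsum_nonneg fun _ => norm_nonneg _)
  have hcross : ∀ p : Nat.Primes, ‖coprimeRestrict g Q (p : ℕ)‖ * Real.log (p : ℕ) *
      ∑' r : ℕ, ‖coprimeRestrict g Q ((p : ℕ) ^ (r + 1))‖ ≤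
      ‖g (p : ℕ)‖ * Real.log (p : ℕ) / (p : ℕ) *
        ∑' r : ℕ, ‖g ((p : ℕ) ^ (r + 1))‖ / ((p : ℕ) : ℝ) ^ (r + 1) := fun p => by
    have h0 := Real.log_natCast_nonneg (p : ℕ)
    refine mul_le_mul ?_ ((hpow p).tsum_le_tsum
      (fun r => norm_coprimeRestrict_pow_le g Q p (r + 1)) (hinner1 p))
      (tsum_nonneg fun _ => norm_nonneg _) (by positivity)
    rw [mul_div_right_comm]
    exact mul_le_mul_of_nonneg_right (norm_coprimeRestrict_le g Q p) h0
  have hhigh1 : ∀ (p : Nat.Primes) (r : ℕ), ‖coprimeRestrict g Q ((p : ℕ) ^ (r + 2))‖ *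
      Real.log (((p : ℕ) : ℝ) ^ (r + 2)) ≤ ‖g ((p : ℕ) ^ (r + 2))‖ *
        Real.log (((p : ℕ) : ℝ) ^ (r + 2)) / ((p : ℕ) : ℝ) ^ (r + 2) := fun p r => by
    rw [mul_div_right_comm]
    exact mul_le_mul_of_nonneg_right (norm_coprimeRestrict_pow_le g Q p (r + 2)) (hlog _ _)
  have hhigh2 : ∀ p : Nat.Primes, Summable fun r : ℕ =>
      ‖coprimeRestrict g Q ((p : ℕ) ^ (r + 2))‖ * Real.log (((p : ℕ) : ℝ) ^ (r + 2)) := fun p =>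
    Summable.of_nonneg_of_le (fun r => mul_nonneg (norm_nonneg _) (hlog _ _)) (hhigh1 p)
      (hinner2 p)
  have hhigh3 : ∀ p : Nat.Primes, ∑' r : ℕ, ‖coprimeRestrict g Q ((p : ℕ) ^ (r + 2))‖ *
      Real.log (((p : ℕ) : ℝ) ^ (r + 2)) ≤ ∑' r : ℕ, ‖g ((p : ℕ) ^ (r + 2))‖ *
        Real.log (((p : ℕ) : ℝ) ^ (r + 2)) / ((p : ℕ) : ℝ) ^ (r + 2) := fun p =>
    (hhigh2 p).tsum_le_tsum (hhigh1 p) (hinner2 p)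
  have hcrossS := Summable.of_nonneg_of_le hcross0 hcross hsum1
  have hhighS := Summable.of_nonneg_of_le
    (fun p => tsum_nonneg fun r => mul_nonneg (norm_nonneg _) (hlog _ _)) hhigh3 hsum2
  refine ⟨?_, ?_, ?_, ?_, hpow, hcrossS, hcrossS.tsum_le_tsum hcross hsum1, hhigh2, hhighS,
    hhighS.tsum_le_tsum hhigh3 hsum2, ?_⟩
  · simp [coprimeRestrict]
  · simp [coprimeRestrict, hg1]
  · intro m n hmn
    simp only [coprimeRestrict, Nat.coprime_mul_iff_left, hmul m n hmn, Nat.cast_mul]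
    split_ifs with h1 h2 h3 h4 h5 <;> simp_all [mul_div_mul_comm]
  · intro w hw
    have h1 := norm_sum_coprimeRestrict_sub_le g hQ (range (⌊w⌋₊ + 1))
    have h2 := hmertens w hw
    rw [add_comm C]
    refine le_trans ?_ (add_le_add h1 h2)
    refine le_trans (le_of_eq ?_) (norm_add_le _ _)
    congr 1
    ring
  · intro x hx
    refine le_trans (prod_le_prod (fun p _ => by positivity) fun p _ => ?_) (hprod x hx)
    gcongr
    exact norm_coprimeRestrict_le g Q p

/-- Proposition B: under the hypotheses of the main mean value
theorem, for every nonzero integer `q`,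
`∑_{n≤x,(n,q)=1} g(n)/n = c_q(g)(log x)^κ + O(δ(q)(log x)^{β−1})` uniformly in
`x ≥ 2` and `q`, with
`c_q(g) = Γ(κ+1)⁻¹ (φ(q)/q)^κ ∏_{p∤q}(1−1/p)^κ(1 + g(p)/p + ⋯)`. -/
theorem stmt_12 (g : ℕ → ℂ) (hg1 : g 1 = 1)
    (hmul : ∀ m n : ℕ, Nat.Coprime m n → g (m * n) = g m * g n)
    (κ : ℂ) (hκ : κ.im ^ 2 < 2 * κ.re + 1)
    (hmertens : ∃ C : ℝ, ∀ w : ℝ, 2 ≤ w →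
      ‖(∑ p ∈ (Finset.range (⌊w⌋₊ + 1)).filter Nat.Prime,
          g p * (Real.log p : ℂ) / (p : ℂ)) - κ * (Real.log w : ℂ)‖ ≤ C)
    (hinner1 : ∀ p : Nat.Primes,
      Summable (fun r : ℕ => ‖g ((p : ℕ) ^ (r + 1))‖ / ((p : ℕ) : ℝ) ^ (r + 1)))
    (hsum1 : Summable (fun p : Nat.Primes =>
      ‖g (p : ℕ)‖ * Real.log (p : ℕ) / (p : ℕ) *
        ∑' r : ℕ, ‖g ((p : ℕ) ^ (r + 1))‖ / ((p : ℕ) : ℝ) ^ (r + 1)))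
    (hinner2 : ∀ p : Nat.Primes, Summable (fun r : ℕ =>
      ‖g ((p : ℕ) ^ (r + 2))‖ * Real.log (((p : ℕ) : ℝ) ^ (r + 2)) / ((p : ℕ) : ℝ) ^ (r + 2)))
    (hsum2 : Summable (fun p : Nat.Primes =>
      ∑' r : ℕ, ‖g ((p : ℕ) ^ (r + 2))‖ * Real.log (((p : ℕ) : ℝ) ^ (r + 2)) / ((p : ℕ) : ℝ) ^ (r + 2)))
    (β : ℝ) (hβ0 : 0 ≤ β) (hβ : β < κ.re + 1)
    (hprod : ∃ C : ℝ, ∀ x : ℝ, 2 ≤ x →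
      ∏ p ∈ (Finset.range (⌊x⌋₊ + 1)).filter Nat.Prime, (1 + ‖g p‖ / p)
        ≤ C * Real.log x ^ β) :
    ∃ C : ℝ, ∀ q : ℤ, q ≠ 0 → ∃ cq : ℂ,
      Tendsto (fun N : ℕ =>
          ((q.natAbs.totient : ℂ) / (q.natAbs : ℂ)) ^ κ *
            ∏ p ∈ (Finset.range N).filter (fun p => p.Prime ∧ ¬ p ∣ q.natAbs),
              (1 - 1 / (p : ℂ)) ^ κ * ∑' r : ℕ, g (p ^ r) / ((p : ℂ) ^ r))
        atTop (nhds (Complex.Gamma (κ + 1) * cq)) ∧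
      ∀ x : ℝ, 2 ≤ x →
        ‖(∑ n ∈ (Finset.Icc 1 ⌊x⌋₊).filter (fun n => Nat.Coprime n q.natAbs),
            g n / (n : ℂ)) - cq * (Real.log x : ℂ) ^ κ‖
          ≤ C * (1 + ∑ p ∈ q.natAbs.primeFactors, ‖g p‖ * Real.log p / p)
              * Real.log x ^ (β - 1) := by
  obtain ⟨C, hC⟩ := hmertens
  obtain ⟨P, hP⟩ := hprod
  have hl2 : 0 < Real.log 2 := Real.log_pos (by norm_num)
  have hC0 : 0 ≤ C := (norm_nonneg _).trans (hC 2 le_rfl)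
  have hP0 : 0 ≤ P := by
    have h1 : 0 ≤ P * Real.log 2 ^ β :=
      (prod_nonneg fun p _ => by positivity).trans (hP 2 le_rfl)
    exact nonneg_of_mul_nonneg_left h1 (Real.rpow_pos_of_pos hl2 β)
  set A := ∑' p : Nat.Primes, ‖g (p : ℕ)‖ * Real.log (p : ℕ) / (p : ℕ) *
    ∑' r : ℕ, ‖g ((p : ℕ) ^ (r + 1))‖ / ((p : ℕ) : ℝ) ^ (r + 1) with hA
  set B := ∑' p : Nat.Primes, ∑' r : ℕ, ‖g ((p : ℕ) ^ (r + 2))‖ *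
    Real.log (((p : ℕ) : ℝ) ^ (r + 2)) / ((p : ℕ) : ℝ) ^ (r + 2) with hB
  have hA0 : 0 ≤ A := tsum_nonneg fun p => by
    have := Real.log_natCast_nonneg (p : ℕ)
    exact mul_nonneg (by positivity) (tsum_nonneg fun r => by positivity)
  have hB0 : 0 ≤ B := tsum_nonneg fun p => tsum_nonneg fun r => by
    have : 0 ≤ Real.log (((p : ℕ) : ℝ) ^ (r + 2)) := by
      exact_mod_cast Real.log_natCast_nonneg ((p : ℕ) ^ (r + 2))
    positivity
  set k := ‖κ + 1‖ / (κ.re + 1 - β) + 1 with hk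
  have hk0 : 0 ≤ k := by
    have := sub_pos.2 hβ
    positivity
  refine ⟨k * ((A + B + C + ‖κ‖ + 1) * (P * Real.exp B)), fun q hq => ?_⟩
  have hQ : q.natAbs ≠ 0 := Int.natAbs_ne_zero.2 hq
  set δ := ∑ p ∈ q.natAbs.primeFactors, ‖g p‖ * Real.log p / p with hδ
  have hδ0 : 0 ≤ δ := sum_nonneg fun p _ => by
    have := Real.log_natCast_nonneg p
    positivity
  have h := meanValueBounds_coprimeRestrict hg1 hmul hC hinner1 hsum1 hinner2 hsum2 hP hQ
  obtain ⟨c, hc⟩ := h.exists_norm_sub_le hβ0 hβ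
  refine ⟨c, ?_, fun x hx => ?_⟩
  · refine (h.tendsto_prod_cpow_mul_tsum (by positivity) hβ0 hβ hc).congr' ?_
    filter_upwards [eventually_gt_atTop q.natAbs] with N hN
    exact prod_coprimeRestrict_eq hg1 hQ hN κ
  · have h1 := hc (Real.log x) (Real.log_le_log (by norm_num) hx)
    rw [expSum_log _ (by linarith)] at h1
    have h2 : ∑ n ∈ (Icc 1 ⌊x⌋₊).filter (fun n => Nat.Coprime n q.natAbs), g n / (n : ℂ) =
        ∑ n ∈ Icc 1 ⌊x⌋₊, coprimeRestrict g q.natAbs n := by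
      rw [sum_filter]
      rfl
    rw [h2]
    refine h1.trans ?_
    have h3 : 0 ≤ Real.log x ^ (β - 1) := Real.rpow_nonneg (Real.log_nonneg (by linarith)) _
    refine mul_le_mul_of_nonneg_right ?_ h3
    rw [mul_assoc k, mul_right_comm (A + B + C + ‖κ‖ + 1)]
    have h4 : A + B + (C + δ) + ‖κ‖ ≤ (A + B + C + ‖κ‖ + 1) * (1 + δ) := by
      have := norm_nonneg κ
      nlinarith [mul_nonneg (by positivity : 0 ≤ A + B + C + ‖κ‖) hδ0]
    gcongr
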